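/- arXiv:math/0410476 — 3 statements merged into one kernel-verified Lean document; each statement's English description precedes it below -/
import Mathlib

section
/- Let n ≥ 2 and let f : S^n → ℝ^{n+1} be a continuous map whose set of injectivity I contains a nonempty open set U, and let q ∈ U. Then there are precisely two connected components of ℝ^{n+1} \ f(S^n) which contain f(q) in their closure; denote them U₁ and U₂. If moreover U₁ is unbounded, then for every continuous map F : D^{n+1} → ℝ^{n+1} whose restriction to S^n equals f (where D^{n+1} is the closed unit ball in ℝ^{n+1} with boundary S^n), the map F surjects onto U₂, i.e. U₂ ⊆ F(D^{n+1}). -/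
/-- `C` is a connected component of the subset `S` of a topological space. -/
def IsConnCompIn {α : Type*} [TopologicalSpace α] (S C : Set α) : Prop :=
  ∃ x ∈ S, C = connectedComponentIn S x

namespace MapDegree

open MeasureTheory Set Metric Bornology Topology Filter

section Smooth

variable {E : Type*} [NormedAddCommGroup E] [InnerProductSpace ℝ E] [FiniteDimensional ℝ E]

/-- For `t` larger than the norm of `A`, the map `t • 1 + A` preserves the orientation. -/
theorem det_smul_one_add_pos (A : E →L[ℝ] E) {t : ℝ} (ht : ‖A‖ < t) :
    0 < (t • ContinuousLinearMap.id ℝ E + A).det := by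
  have ht0 : 0 < t := (norm_nonneg A).trans_lt ht
  set D : ℝ → ℝ := fun s => (t • ContinuousLinearMap.id ℝ E + s • A).det with hD
  have hcont : Continuous D := by
    have := ContinuousLinearMap.continuous_det (𝕜 := ℝ) (E := E)
    exact this.comp (by fun_prop)
  have hne : ∀ s ∈ Icc (0 : ℝ) 1, D s ≠ 0 := by
    intro s hs h0
    have := LinearMap.bot_lt_ker_of_det_eq_zero h0
    obtain ⟨v, hv, hv0⟩ := (Submodule.ne_bot_iff _).1 this.ne'
    have hv' : t • v + s • A v = 0 := by simpa using hv
    have h1 : t * ‖v‖ = s * ‖A v‖ := by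
      have : t • v = -(s • A v) := eq_neg_of_add_eq_zero_left hv'
      have := congrArg norm this
      rwa [norm_neg, norm_smul, norm_smul, Real.norm_of_nonneg ht0.le,
        Real.norm_of_nonneg hs.1] at this
    have h2 := A.le_opNorm v
    have h3 : 0 < ‖v‖ := norm_pos_iff.2 hv0
    have h4 : s * ‖A v‖ ≤ ‖A v‖ := mul_le_of_le_one_left (norm_nonneg _) hs.2
    nlinarith
  have h0 : 0 < D 0 := by
    have : D 0 = t ^ Module.finrank ℝ E := by
      simp only [hD, zero_smul, add_zero]
      rw [ContinuousLinearMap.det]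
      simp
    rw [this]; positivity
  by_contra hcon
  have h1 : D 1 ≤ 0 := by
    simp only [hD, one_smul]; exact not_lt.1 hcon
  obtain ⟨s, hs, hs0⟩ := intermediate_value_Icc' zero_le_one hcont.continuousOn ⟨h1, h0.le⟩
  exact hne s hs hs0

/-- Functions of `(t, x)` which are polynomial in `t` with coefficients continuous in `x`. -/
noncomputable def polyFamily (X : Type*) [TopologicalSpace X] : Subring (ℝ → X → ℝ) :=
  (RingHom.pi fun t => RingHom.pi fun x =>
    (ContinuousMap.evalAlgHom ℝ ℝ x : C(X, ℝ) →ₐ[ℝ] ℝ).toRingHom.comp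
      (Polynomial.evalRingHom (ContinuousMap.const X t))).range

theorem mem_polyFamily {X : Type*} [TopologicalSpace X] {p : ℝ → X → ℝ} :
    p ∈ polyFamily X ↔
      ∃ P : Polynomial C(X, ℝ), ∀ t x, p t x = P.eval (ContinuousMap.const X t) x :=
  ⟨fun ⟨P, hP⟩ => ⟨P, fun t x => (congrFun₂ hP t x).symm⟩,
    fun ⟨P, hP⟩ => ⟨P, funext₂ fun t x => (hP t x).symm⟩⟩

theorem mem_polyFamily_of_continuous {X : Type*} [TopologicalSpace X] {a : X → ℝ}
    (ha : Continuous a) : (fun _ x => a x : ℝ → X → ℝ) ∈ polyFamily X :=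
  mem_polyFamily.2 ⟨Polynomial.C ⟨a, ha⟩, fun t x => by simp⟩

theorem mem_polyFamily_param {X : Type*} [TopologicalSpace X] :
    (fun t _ => t : ℝ → X → ℝ) ∈ polyFamily X :=
  mem_polyFamily.2 ⟨Polynomial.X, fun t x => by simp⟩

theorem continuous_det_fderiv {E : Type*} [NormedAddCommGroup E] [InnerProductSpace ℝ E]
    {g : E → E} (hg : ContDiff ℝ 1 g) :
    Continuous fun x => (fderiv ℝ g x).det :=
  (ContinuousLinearMap.continuous_det (𝕜 := ℝ) (E := E)).comp (hg.continuous_fderiv one_ne_zero)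

theorem fderiv_smul_id_add {E : Type*} [NormedAddCommGroup E] [InnerProductSpace ℝ E]
    {f : E → E} (hf : ContDiff ℝ 1 f) (t : ℝ) (x : E) :
    HasFDerivAt (fun x => t • x + f x) (t • ContinuousLinearMap.id ℝ E + fderiv ℝ f x) x :=
  ((hasFDerivAt_id x).const_smul t).add (hf.differentiable one_ne_zero x).hasFDerivAt

theorem det_mem_polyFamily {f : E → E} (hf : ContDiff ℝ 1 f) :
    (fun t x => (t • ContinuousLinearMap.id ℝ E + fderiv ℝ f x).det : ℝ → E → ℝ)
      ∈ polyFamily E := by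
  classical
  set b := stdOrthonormalBasis ℝ E
  have key : (fun t x => (t • ContinuousLinearMap.id ℝ E + fderiv ℝ f x).det : ℝ → E → ℝ) =
      ∑ σ : Equiv.Perm (Fin (Module.finrank ℝ E)), (Equiv.Perm.sign σ : ℤ) •
        ∏ i, (fun t x => t * inner ℝ (b (σ i)) (b i) +
          inner ℝ (b (σ i)) (fderiv ℝ f x (b i)) : ℝ → E → ℝ) := by
    ext t x
    rw [ContinuousLinearMap.det, ← LinearMap.det_toMatrix b.toBasis, Matrix.det_apply]
    simp only [Finset.sum_apply, Pi.smul_apply, Finset.prod_apply]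
    refine Finset.sum_congr rfl fun σ _ => ?_
    rw [Units.smul_def]
    congr 1
    refine Finset.prod_congr rfl fun i _ => ?_
    rw [LinearMap.toMatrix_apply]
    simp only [OrthonormalBasis.coe_toBasis, ContinuousLinearMap.coe_coe,
      add_apply, smul_apply, ContinuousLinearMap.id_apply,
      OrthonormalBasis.coe_toBasis_repr_apply, OrthonormalBasis.repr_apply_apply,
      inner_add_right, inner_smul_right]
  rw [key]
  refine Subring.sum_mem _ fun σ _ => Subring.zsmul_mem _ (Subring.prod_mem _ fun i _ => ?_) _
  have hc := hf.continuous_fderiv one_ne_zero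
  exact Subring.add_mem _ (Subring.mul_mem _ mem_polyFamily_param
    (mem_polyFamily_of_continuous continuous_const))
    (mem_polyFamily_of_continuous (by fun_prop))

theorem bijective_smul_id_add {f : E → E} {C : NNReal} (hC : LipschitzWith C f) {t : ℝ}
    (ht : (C : ℝ) < t) : Function.Bijective fun x => t • x + f x := by
  have ht0 : 0 < t := C.2.trans_lt ht
  constructor
  · intro x y hxy
    have h1 : t • (x - y) = f y - f x := by
      rw [smul_sub, sub_eq_sub_iff_add_eq_add]
      simpa [add_comm] using hxy
    have h2 : t * ‖x - y‖ = ‖f y - f x‖ := by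
      rw [← h1, norm_smul, Real.norm_of_nonneg ht0.le]
    have h3 := hC.dist_le_mul y x
    rw [dist_eq_norm, dist_eq_norm, norm_sub_rev y x] at h3
    by_contra hne
    have : 0 < ‖x - y‖ := norm_pos_iff.2 (sub_ne_zero.2 hne)
    nlinarith
  · intro y
    have hK : ContractingWith (C * ⟨t⁻¹, by positivity⟩) (fun x => t⁻¹ • (y - f x)) := by
      constructor
      · rw [← NNReal.coe_lt_coe]
        change (C : ℝ) * t⁻¹ < 1
        rwa [← div_eq_mul_inv, div_lt_one ht0]
      · refine LipschitzWith.of_dist_le_mul fun a b => ?_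
        have h3 := hC.dist_le_mul a b
        rw [dist_smul₀, dist_sub_left, Real.norm_of_nonneg (by positivity)]
        change _ ≤ (C : ℝ) * t⁻¹ * _
        have : 0 < t⁻¹ := by positivity
        nlinarith
    refine ⟨hK.fixedPoint, ?_⟩
    have h1 := hK.fixedPoint_isFixedPt
    change t⁻¹ • (y - f _) = _ at h1
    beta_reduce
    rw [← h1, smul_inv_smul₀ ht0.ne', h1]
    abel

/-- The subalgebra of those `h` for which `h (t • x + f x)` depends polynomially on `t`. -/
noncomputable def polyAlg (f : E → E) : Subalgebra ℝ C(E, ℝ) where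
  carrier := {h | (fun t x => h (t • x + f x) : ℝ → E → ℝ) ∈ polyFamily E}
  mul_mem' {a b} ha hb := by
    change (fun t x => a (t • x + f x) * b (t • x + f x) : ℝ → E → ℝ) ∈ polyFamily E
    exact Subring.mul_mem _ ha hb
  add_mem' {a b} ha hb := by
    change (fun t x => a (t • x + f x) + b (t • x + f x) : ℝ → E → ℝ) ∈ polyFamily E
    exact Subring.add_mem _ ha hb
  algebraMap_mem' r := mem_polyFamily_of_continuous (a := fun _ => r) continuous_const

theorem mem_polyAlg {E : Type*} [NormedAddCommGroup E] [InnerProductSpace ℝ E]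
    {f : E → E} {h : C(E, ℝ)} :
    h ∈ polyAlg f ↔ (fun t x => h (t • x + f x) : ℝ → E → ℝ) ∈ polyFamily E :=
  Iff.rfl

theorem separatesPoints_polyAlg {E : Type*} [NormedAddCommGroup E] [InnerProductSpace ℝ E]
    (f₁ f₂ : E → E) (h₁ : Continuous f₁) (h₂ : Continuous f₂) :
    (polyAlg f₁ ⊓ polyAlg f₂).SeparatesPoints := by
  intro x y hxy
  have hl : ∀ f : E → E, Continuous f →
      (⟨fun z => inner ℝ (x - y) z, by fun_prop⟩ : C(E, ℝ)) ∈ polyAlg f := by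
    intro f hf
    rw [mem_polyAlg]
    simp only [ContinuousMap.coe_mk, inner_add_right, inner_smul_right]
    exact Subring.add_mem _ (Subring.mul_mem _ mem_polyFamily_param
      (mem_polyFamily_of_continuous (by fun_prop))) (mem_polyFamily_of_continuous (by fun_prop))
  refine ⟨_, ⟨_, ⟨hl f₁ h₁, hl f₂ h₂⟩, rfl⟩, ?_⟩
  simp only [ContinuousMap.coe_mk]
  rw [← sub_ne_zero, ← inner_sub_right]
  exact inner_self_ne_zero.2 (sub_ne_zero.2 hxy)

variable [MeasurableSpace E] [BorelSpace E]

theorem integrableOn_of_continuous {g : E → ℝ} (hg : Continuous g) {Ω : Set E}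
    (hΩ : IsBounded Ω) : IntegrableOn g Ω :=
  (hg.continuousOn.integrableOn_compact hΩ.isCompact_closure).mono_set subset_closure

theorem exists_polynomial_setIntegral {p : ℝ → E → ℝ} (hp : p ∈ polyFamily E) {Ω : Set E}
    (hΩ : IsBounded Ω) : ∃ Q : Polynomial ℝ, ∀ t, ∫ x in Ω, p t x = Q.eval t := by
  obtain ⟨P, hP⟩ := mem_polyFamily.1 hp
  refine ⟨∑ k ∈ P.support, Polynomial.monomial k (∫ x in Ω, P.coeff k x), fun t => ?_⟩
  have : ∀ x, (P.eval (ContinuousMap.const E t)) x = ∑ k ∈ P.support, P.coeff k x * t ^ k := by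
    intro x
    rw [Polynomial.eval_eq_sum, Polynomial.sum]
    simp
  simp only [Polynomial.eval_finsetSum, Polynomial.eval_monomial, hP, this]
  rw [integral_finsetSum]
  · simp only [integral_mul_const]
  · intro k _
    exact (integrableOn_of_continuous (P.coeff k).continuous hΩ).mul_const _

/-- The integral of `h` pulled back along `g`, weighted with the Jacobian determinant. -/
noncomputable def degInt (g : E → E) (Ω : Set E) (h : E → ℝ) : ℝ :=
  ∫ x in Ω, h (g x) * (fderiv ℝ g x).det

theorem degInt_eq_of_mem_polyAlg {f₁ f₂ : E → E} (h₁ : ContDiff ℝ 1 f₁) (h₂ : ContDiff ℝ 1 f₂)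
    {C : NNReal} (hC₁ : ∀ x, ‖fderiv ℝ f₁ x‖₊ ≤ C) (hC₂ : ∀ x, ‖fderiv ℝ f₂ x‖₊ ≤ C)
    {Ω : Set E} (hΩ : IsBounded Ω) (hΩm : MeasurableSet Ω) (heq : EqOn f₁ f₂ Ωᶜ)
    {h : C(E, ℝ)} (hh₁ : h ∈ polyAlg f₁) (hh₂ : h ∈ polyAlg f₂) :
    degInt f₁ Ω h = degInt f₂ Ω h := by
  obtain ⟨Q₁, hQ₁⟩ := exists_polynomial_setIntegral
    ((polyFamily E).mul_mem (mem_polyAlg.1 hh₁) (det_mem_polyFamily h₁)) hΩ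
  obtain ⟨Q₂, hQ₂⟩ := exists_polynomial_setIntegral
    ((polyFamily E).mul_mem (mem_polyAlg.1 hh₂) (det_mem_polyFamily h₂)) hΩ
  have change_var : ∀ {f : E → E}, ContDiff ℝ 1 f → (∀ x, ‖fderiv ℝ f x‖₊ ≤ C) → ∀ t : ℝ, C < t →
      ∫ y in (fun x => t • x + f x) '' Ω, h y =
      ∫ x in Ω, h (t • x + f x) * (t • ContinuousLinearMap.id ℝ E + fderiv ℝ f x).det := by
    intro f hf hfC t ht
    have hL : LipschitzWith C f :=
      lipschitzWith_of_nnnorm_fderiv_le (hf.differentiable one_ne_zero) hfC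
    rw [integral_image_eq_integral_abs_det_fderiv_smul volume hΩm
      (fun x _ => (fderiv_smul_id_add hf t x).hasFDerivWithinAt)
      (bijective_smul_id_add hL ht).1.injOn]
    refine setIntegral_congr_fun hΩm fun x _ => ?_
    have := det_smul_one_add_pos (fderiv ℝ f x) (t := t) (lt_of_le_of_lt (by exact_mod_cast hfC x) ht)
    simp only [abs_of_pos this, smul_eq_mul, mul_comm]
  have himage : ∀ t : ℝ, C < t →
      (fun x => t • x + f₁ x) '' Ω = (fun x => t • x + f₂ x) '' Ω := by
    intro t ht
    have b₁ := bijective_smul_id_add (lipschitzWith_of_nnnorm_fderiv_le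
      (h₁.differentiable one_ne_zero) hC₁) ht
    have b₂ := bijective_smul_id_add (lipschitzWith_of_nnnorm_fderiv_le
      (h₂.differentiable one_ne_zero) hC₂) ht
    rw [← compl_inj_iff, ← image_compl_eq b₁, ← image_compl_eq b₂]
    exact image_congr fun x hx => by rw [heq hx]
  have hQ : Q₁ = Q₂ := by
    refine Polynomial.eq_of_infinite_eval_eq _ _ ((Ioi_infinite (C : ℝ)).mono fun t ht => ?_)
    change Q₁.eval t = Q₂.eval t
    rw [← hQ₁, ← hQ₂]
    have e₁ := change_var h₁ hC₁ t ht
    have e₂ := change_var h₂ hC₂ t ht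
    rw [himage t ht, e₂] at e₁
    exact e₁.symm
  have e₁ := hQ₁ 0
  have e₂ := hQ₂ 0
  rw [← hQ, ← e₁] at e₂
  simpa [degInt] using e₂.symm

theorem abs_degInt_sub_le {g : E → E} (hg : ContDiff ℝ 1 g) {Ω : Set E} (hΩ : IsBounded Ω)
    (hΩm : MeasurableSet Ω) {h k : E → ℝ} (hh : Continuous h) (hk : Continuous k) {ε : ℝ}
    (hε : ∀ x ∈ Ω, |h (g x) - k (g x)| ≤ ε) :
    |degInt g Ω h - degInt g Ω k| ≤ ε * ∫ x in Ω, |(fderiv ℝ g x).det| := by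
  have hd := continuous_det_fderiv hg
  have hgc := hg.continuous
  rw [degInt, degInt, ← integral_sub (integrableOn_of_continuous (by fun_prop) hΩ)
    (integrableOn_of_continuous (by fun_prop) hΩ), ← integral_const_mul]
  refine (abs_integral_le_integral_abs).trans (setIntegral_mono_on
    (integrableOn_of_continuous (by fun_prop) hΩ)
    (integrableOn_of_continuous (by fun_prop) hΩ) hΩm fun x hx => ?_)
  rw [← sub_mul, abs_mul]
  exact mul_le_mul_of_nonneg_right (hε x hx) (abs_nonneg _)

theorem degInt_eq_of_bounded_fderiv {f₁ f₂ : E → E} (h₁ : ContDiff ℝ 1 f₁)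
    (h₂ : ContDiff ℝ 1 f₂) {C : NNReal} (hC₁ : ∀ x, ‖fderiv ℝ f₁ x‖₊ ≤ C)
    (hC₂ : ∀ x, ‖fderiv ℝ f₂ x‖₊ ≤ C) {Ω : Set E} (hΩ : IsBounded Ω) (hΩm : MeasurableSet Ω)
    (heq : EqOn f₁ f₂ Ωᶜ) {h : E → ℝ} (hh : Continuous h) :
    degInt f₁ Ω h = degInt f₂ Ω h := by
  set M := (∫ x in Ω, |(fderiv ℝ f₁ x).det|) + ∫ x in Ω, |(fderiv ℝ f₂ x).det| with hM
  have hM0 : 0 ≤ M := add_nonneg (integral_nonneg fun _ => abs_nonneg _)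
    (integral_nonneg fun _ => abs_nonneg _)
  have hK : IsCompact (f₁ '' closure Ω ∪ f₂ '' closure Ω) :=
    (hΩ.isCompact_closure.image h₁.continuous).union (hΩ.isCompact_closure.image h₂.continuous)
  rw [← sub_eq_zero, ← abs_nonpos_iff]
  refine le_of_forall_pos_le_add fun ε hε => ?_
  obtain ⟨k, hk, hkK⟩ :=
    ContinuousMap.exists_mem_subalgebra_near_continuous_of_isCompact_of_separatesPoints
      (separatesPoints_polyAlg f₁ f₂ h₁.continuous h₂.continuous) ⟨h, hh⟩ hK
      (ε := ε / (M + 1)) (by positivity)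
  have e := degInt_eq_of_mem_polyAlg h₁ h₂ hC₁ hC₂ hΩ hΩm heq hk.1 hk.2
  have a₁ := abs_degInt_sub_le h₁ hΩ hΩm k.continuous hh (fun x hx =>
    (hkK _ (Or.inl (mem_image_of_mem _ (subset_closure hx)))).le)
  have a₂ := abs_degInt_sub_le h₂ hΩ hΩm k.continuous hh (fun x hx =>
    (hkK _ (Or.inr (mem_image_of_mem _ (subset_closure hx)))).le)
  rw [e] at a₁
  have : |degInt f₁ Ω h - degInt f₂ Ω h| ≤ ε / (M + 1) * M := by
    rw [hM, mul_add]
    calc _ = |(degInt f₂ Ω k - degInt f₂ Ω h) - (degInt f₂ Ω k - degInt f₁ Ω h)| := by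
          congr 1; ring
      _ ≤ _ := (abs_sub _ _).trans (by linarith)
  refine this.trans ?_
  rw [div_mul_eq_mul_div, zero_add, div_le_iff₀ (by positivity)]
  nlinarith

theorem degInt_congr {f₁ f₂ : E → E} {Ω : Set E} (hΩ : IsOpen Ω) (h : E → ℝ)
    (heq : EqOn f₁ f₂ Ω) : degInt f₁ Ω h = degInt f₂ Ω h :=
  setIntegral_congr_fun hΩ.measurableSet fun x hx => by
    simp only [heq hx, (heq.eventuallyEq_of_mem (hΩ.mem_nhds hx)).fderiv_eq]

/-- The weighted integral only depends on the values of the map off an open set. -/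
theorem degInt_eq_of_eqOn_compl {f₁ f₂ : E → E} (h₁ : ContDiff ℝ 1 f₁)
    (h₂ : ContDiff ℝ 1 f₂) {Ω : Set E} (hΩ : IsBounded Ω) (hΩo : IsOpen Ω)
    (heq : EqOn f₁ f₂ Ωᶜ) {h : E → ℝ} (hh : Continuous h) :
    degInt f₁ Ω h = degInt f₂ Ω h := by
  obtain ⟨R, hR, hΩR⟩ := hΩ.subset_ball_lt 0 0
  let θ : ContDiffBump (0 : E) := ⟨R, R + 1, hR, by linarith⟩
  have hθ : ∀ f : E → E, EqOn f (fun x => θ x • f x) Ω := fun f x hx => by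
    beta_reduce
    rw [θ.one_of_mem_closedBall (ball_subset_closedBall (hΩR hx)), one_smul]
  have hcd : ∀ {f : E → E}, ContDiff ℝ 1 f → ContDiff ℝ 1 fun x => θ x • f x :=
    fun hf => θ.contDiff.smul hf
  have hb : ∀ {f : E → E}, ContDiff ℝ 1 f →
      ∃ C : NNReal, ∀ x, ‖fderiv ℝ (fun x => θ x • f x) x‖₊ ≤ C := by
    intro f hf
    have hs : HasCompactSupport fun x => θ x • f x := θ.hasCompactSupport.smul_right
    obtain ⟨C, hC⟩ := (((hcd hf).continuous_fderiv one_ne_zero).norm).bounded_above_of_compact_support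
      (hs.fderiv ℝ).norm
    refine ⟨C.toNNReal, fun x => ?_⟩
    rw [← NNReal.coe_le_coe]
    simpa using Or.inl (hC x)
  obtain ⟨C₁, hC₁⟩ := hb h₁
  obtain ⟨C₂, hC₂⟩ := hb h₂
  rw [degInt_congr hΩo h (hθ f₁), degInt_congr hΩo h (hθ f₂)]
  exact degInt_eq_of_bounded_fderiv (hcd h₁) (hcd h₂)
    (fun x => (hC₁ x).trans (le_max_left C₁ C₂)) (fun x => (hC₂ x).trans (le_max_right C₁ C₂))
    hΩ hΩo.measurableSet (fun x hx => by simp only [heq hx]) hh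

end Smooth

section Smooth

variable {E : Type*} [NormedAddCommGroup E] [InnerProductSpace ℝ E] [FiniteDimensional ℝ E]
  [MeasurableSpace E] [BorelSpace E]

theorem degInt_eq_of_eventually {f₁ f₂ : E → E} {Ω : Set E} (hΩ : IsOpen Ω) {h : E → ℝ}
    (H : ∀ x ∈ Ω, f₁ =ᶠ[𝓝 x] f₂ ∨ (h (f₁ x) = 0 ∧ h (f₂ x) = 0)) :
    degInt f₁ Ω h = degInt f₂ Ω h := by
  refine setIntegral_congr_fun hΩ.measurableSet fun x hx => ?_
  rcases H x hx with hx' | ⟨h₁, h₂⟩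
  · simp only [hx'.eq_of_nhds, hx'.fderiv_eq]
  · simp only [h₁, h₂, zero_mul]

/-- Homotopy invariance: the weighted integral does not change along a straight homotopy which
avoids the support of the weight on the boundary. -/
theorem degInt_eq_of_lineMap_notMem {g₁ g₂ : E → E} (h₁ : ContDiff ℝ 1 g₁)
    (h₂ : ContDiff ℝ 1 g₂) {Ω : Set E} (hΩ : IsBounded Ω) (hΩo : IsOpen Ω)
    {h : E → ℝ} (hh : Continuous h) {S : Set E} (hS : IsClosed S) (hhS : Function.support h ⊆ S)
    (H : ∀ x ∈ frontier Ω, ∀ t ∈ Icc (0 : ℝ) 1, AffineMap.lineMap (g₁ x) (g₂ x) t ∉ S) :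
    degInt g₁ Ω h = degInt g₂ Ω h := by
  have c₁ := h₁.continuous
  have c₂ := h₂.continuous
  set N : Set E := {x | ∀ t ∈ Icc (0 : ℝ) 1, AffineMap.lineMap (g₁ x) (g₂ x) t ∉ S} with hN
  have hNo : IsOpen N := by
    rw [isOpen_iff_eventually]
    intro x hx
    refine isCompact_Icc.eventually_forall_of_forall_eventually fun t ht => ?_
    have hc : Continuous fun p : E × ℝ => AffineMap.lineMap (g₁ p.1) (g₂ p.1) p.2 := by
      simp only [AffineMap.lineMap_apply_module]
      fun_prop
    exact (hc.continuousAt (x := (x, t))).eventually (hS.isOpen_compl.mem_nhds (hx t ht))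
  have hK : IsClosed (Ω \ N) := by
    have : Ω \ N = closure Ω \ N := by
      ext x
      refine ⟨fun hx => ⟨subset_closure hx.1, hx.2⟩, fun hx => ⟨?_, hx.2⟩⟩
      by_contra hxΩ
      exact hx.2 (H x ⟨hx.1, fun hi => hxΩ (interior_subset hi)⟩)
    rw [this]
    exact isClosed_closure.sdiff hNo
  obtain ⟨χ, hχ₁, hχ₀, hχI⟩ := exists_contMDiffMap_one_nhds_of_subset_interior
    (modelWithCornersSelf ℝ E) (n := 1) hK (t := Ω) (by rw [hΩo.interior_eq]; exact sdiff_subset)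
  have hχc : ContDiff ℝ 1 χ := χ.contMDiff.contDiff
  set g₃ : E → E := fun x => g₂ x + χ x • (g₁ x - g₂ x) with hg₃
  have h₃ : ContDiff ℝ 1 g₃ := h₂.add (hχc.smul (h₁.sub h₂))
  rw [← degInt_eq_of_eqOn_compl h₃ h₂ hΩ hΩo (fun x hx => by simp [hg₃, hχ₀ x hx]) hh]
  refine degInt_eq_of_eventually hΩo fun x hx => ?_
  by_cases hxN : x ∈ N
  · right
    have hz : ∀ z, z ∉ S → h z = 0 := fun z hz => by
      by_contra hne; exact hz (hhS hne)
    refine ⟨hz _ ?_, hz _ ?_⟩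
    · simpa using hxN 0 (by simp)
    · have := hxN (1 - χ x) ⟨by linarith [(hχI x).2], by linarith [(hχI x).1]⟩
      have e : AffineMap.lineMap (g₁ x) (g₂ x) (1 - χ x) = g₃ x := by
        simp only [hg₃, AffineMap.lineMap_apply_module]
        module
      rwa [e] at this
  · left
    filter_upwards [eventually_nhdsSet_iff_forall.1 hχ₁ x ⟨hx, hxN⟩] with z hz
    simp [hg₃, hz]

/-- Integrals against `h` of functions constant on the support of `h`. -/
theorem integral_mul_eq_of_support {h u : E → ℝ} {c : ℝ} {S : Set E}
    (hS : Function.support h ⊆ S) (hu : ∀ z ∈ S, u z = c) :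
    ∫ z, h z * u z = c * ∫ z, h z := by
  rw [← integral_const_mul]
  refine integral_congr_ae (.of_forall fun z => ?_)
  by_cases hz : h z = 0
  · simp [hz]
  · simp only [hu z (hS hz), mul_comm]

theorem degInt_translate {g : E → E} (hg : ContDiff ℝ 1 g) {Ω : Set E} (hΩ : IsBounded Ω)
    (hΩo : IsOpen Ω) {h : E → ℝ} (hh : Continuous h) {y v : E} {δ : ℝ} (hv : ‖v‖ < δ)
    (hhy : Function.support h ⊆ ball y δ) (H : ∀ x ∈ frontier Ω, 2 * δ ≤ dist (g x) y) :
    ∫ x in Ω, h (g x + v) * (fderiv ℝ g x).det = degInt g Ω h := by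
  have : degInt (fun x => g x + v) Ω h = ∫ x in Ω, h (g x + v) * (fderiv ℝ g x).det := by
    simp only [degInt, fderiv_add_const]
  rw [← this]
  refine degInt_eq_of_lineMap_notMem (hg.add contDiff_const) hg hΩ hΩo hh
    (isClosed_closedBall (x := y) (ε := δ)) (hhy.trans ball_subset_closedBall) ?_
  intro x hx t ht hmem
  have h1 : AffineMap.lineMap (g x + v) (g x) t = g x + (1 - t) • v := by
    simp only [AffineMap.lineMap_apply_module, sub_smul, smul_add, one_smul]
    module
  rw [h1, mem_closedBall] at hmem
  have h2 : dist (g x) (g x + (1 - t) • v) ≤ ‖v‖ := by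
    rw [dist_self_add_right, norm_smul, Real.norm_of_nonneg (by linarith [ht.2])]
    exact mul_le_of_le_one_left (norm_nonneg _) (by linarith [ht.1])
  have := H x hx
  linarith [dist_triangle (g x) (g x + (1 - t) • v) y]

theorem integral_convolution_mul_det {g : E → E} (hg : ContDiff ℝ 1 g) {Ω : Set E}
    (hΩ : IsBounded Ω) (hΩo : IsOpen Ω) {h ρ : E → ℝ} (hh : Continuous h) (hρ : Continuous ρ)
    {y : E} {δ : ℝ} (hhy : Function.support h ⊆ ball y δ) (hρy : Function.support ρ ⊆ ball y δ)
    (H : ∀ x ∈ frontier Ω, 2 * δ ≤ dist (g x) y) :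
    ∫ x in Ω, (∫ z, h z * ρ (g x + y - z)) * (fderiv ℝ g x).det =
      degInt g Ω ρ * ∫ z, h z := by
  have hgc := hg.continuous
  have hdc := continuous_det_fderiv hg
  have cs : ∀ {k : E → ℝ}, Function.support k ⊆ ball y δ → HasCompactSupport k := fun hk =>
    HasCompactSupport.of_support_subset_isCompact (isCompact_closedBall y δ)
      (hk.trans ball_subset_closedBall)
  obtain ⟨B, hB⟩ := hρ.bounded_above_of_compact_support (cs hρy)
  have hInt : Integrable (fun p : E × E => ρ (g p.1 + y - p.2) * ((fderiv ℝ g p.1).det * h p.2))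
      ((volume.restrict Ω).prod volume) := by
    refine Integrable.bdd_mul (c := B) ?_ ?_ ?_
    · exact (integrableOn_of_continuous hdc hΩ).mul_prod
        (hh.integrable_of_hasCompactSupport (cs hhy))
    · exact (by fun_prop : Continuous fun p : E × E => ρ (g p.1 + y - p.2)).aestronglyMeasurable
    · exact .of_forall fun p => hB _
  have e₁ : ∫ x in Ω, (∫ z, h z * ρ (g x + y - z)) * (fderiv ℝ g x).det =
      ∫ x in Ω, ∫ z, ρ (g x + y - z) * ((fderiv ℝ g x).det * h z) := by
    congr 1 with x
    rw [← integral_mul_const]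
    congr 1 with z
    ring
  rw [e₁, integral_integral_swap hInt]
  rw [← integral_mul_eq_of_support (u := fun z => ∫ x in Ω, ρ (g x + y - z) * (fderiv ℝ g x).det)
    hhy]
  · congr 1 with z
    rw [← integral_const_mul]
    congr 1 with x
    ring
  · intro z hz
    simp only [add_sub_assoc]
    refine degInt_translate hg hΩ hΩo hρ ?_ hρy H
    rwa [← dist_eq_norm, dist_comm]

theorem degInt_mul_integral_comm {g : E → E} (hg : ContDiff ℝ 1 g) {Ω : Set E}
    (hΩ : IsBounded Ω) (hΩo : IsOpen Ω) {h ρ : E → ℝ} (hh : Continuous h) (hρ : Continuous ρ)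
    {y : E} {δ : ℝ} (hhy : Function.support h ⊆ ball y δ) (hρy : Function.support ρ ⊆ ball y δ)
    (H : ∀ x ∈ frontier Ω, 2 * δ ≤ dist (g x) y) :
    degInt g Ω h * ∫ z, ρ z = degInt g Ω ρ * ∫ z, h z := by
  rw [← integral_convolution_mul_det hg hΩ hΩo hh hρ hhy hρy H,
    ← integral_convolution_mul_det hg hΩ hΩo hρ hh hρy hhy H]
  congr 1 with x
  congr 1
  rw [← integral_sub_left_eq_self _ volume (g x + y)]
  congr 1 with z
  rw [sub_sub_cancel, mul_comm]

end Smooth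

section Degree

variable {E : Type*} [NormedAddCommGroup E] [InnerProductSpace ℝ E] [FiniteDimensional ℝ E]
  [MeasurableSpace E] [BorelSpace E]

/-- `d` is the (real-valued) Brouwer degree of `f` on `Ω` at `y`: all smooth maps close to `f` on
the boundary of `Ω` multiply integrals of functions supported near `y` by `d`. -/
def HasDeg (f : E → E) (Ω : Set E) (y : E) (d : ℝ) : Prop :=
  ∃ δ > 0, ∀ g : E → E, ContDiff ℝ 1 g → (∀ x ∈ frontier Ω, dist (g x) (f x) < δ) →
    ∀ h : E → ℝ, Continuous h → Function.support h ⊆ ball y δ → degInt g Ω h = d * ∫ z, h z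

theorem exists_contDiff_near {E : Type*} [NormedAddCommGroup E] [NormedSpace ℝ E]
    [FiniteDimensional ℝ E] {f : E → E} (hf : Continuous f) {δ : ℝ} (hδ : 0 < δ) :
    ∃ g : E → E, ContDiff ℝ 1 g ∧ ∀ x, dist (g x) (f x) < δ := by
  obtain ⟨g, hg, hgf, -⟩ := hf.exists_contDiff_approx 1 continuous_const (fun _ => hδ)
  exact ⟨g, by exact_mod_cast hg, hgf⟩

theorem exists_integral_eq_one (y : E) {δ : ℝ} (hδ : 0 < δ) :
    ∃ h : E → ℝ, Continuous h ∧ Function.support h ⊆ ball y δ ∧ ∫ z, h z = 1 := by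
  let θ : ContDiffBump y := ⟨δ / 2, δ, by linarith, by linarith⟩
  exact ⟨θ.normed volume, θ.continuous_normed, by rw [θ.support_normed_eq], θ.integral_normed⟩

theorem HasDeg.unique {f : E → E} (hf : Continuous f) {Ω : Set E} {y : E} {d d' : ℝ}
    (h : HasDeg f Ω y d) (h' : HasDeg f Ω y d') : d = d' := by
  obtain ⟨δ, hδ, H⟩ := h
  obtain ⟨δ', hδ', H'⟩ := h'
  obtain ⟨g, hg, hgf⟩ := exists_contDiff_near hf (lt_min hδ hδ')
  obtain ⟨ρ, hρ, hρs, hρ1⟩ := exists_integral_eq_one y (lt_min hδ hδ')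
  have e := H g hg (fun x _ => (hgf x).trans_le (min_le_left _ _)) ρ hρ
    (hρs.trans (ball_subset_ball (min_le_left _ _)))
  have e' := H' g hg (fun x _ => (hgf x).trans_le (min_le_right _ _)) ρ hρ
    (hρs.trans (ball_subset_ball (min_le_right _ _)))
  rw [hρ1] at e e'
  linarith

theorem exists_le_dist_of_notMem_image {E : Type*} [MetricSpace E] {X : Type*}
    [TopologicalSpace X] {f : X → E}
    (hf : Continuous f) {K : Set X} (hK : IsCompact K) {y : E} (hy : y ∉ f '' K) :
    ∃ r > 0, ∀ x ∈ K, r ≤ dist (f x) y := by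
  obtain ⟨r, hr, hb⟩ := Metric.isOpen_iff.1 (hK.image hf).isClosed.isOpen_compl y hy
  refine ⟨r, hr, fun x hx => ?_⟩
  by_contra! hlt
  exact hb (mem_ball.2 hlt) (mem_image_of_mem f hx)

theorem isCompact_frontier {E : Type*} [PseudoMetricSpace E] [ProperSpace E] {Ω : Set E}
    (hΩ : IsBounded Ω) :
    IsCompact (frontier Ω) :=
  hΩ.isCompact_closure.of_isClosed_subset isClosed_frontier frontier_subset_closure

theorem HasDeg.exists {f : E → E} (hf : Continuous f) {Ω : Set E} (hΩ : IsBounded Ω)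
    (hΩo : IsOpen Ω) {y : E} (hy : y ∉ f '' frontier Ω) : ∃ d, HasDeg f Ω y d := by
  obtain ⟨r, hr, H⟩ := exists_le_dist_of_notMem_image hf (isCompact_frontier hΩ) hy
  obtain ⟨g₀, hg₀, hgf₀⟩ := exists_contDiff_near hf (δ := r / 4) (by linarith)
  obtain ⟨ρ, hρ, hρs, hρ1⟩ := exists_integral_eq_one y (δ := r / 4) (by linarith)
  refine ⟨degInt g₀ Ω ρ, r / 4, by linarith, fun g hg hgf h hh hhs => ?_⟩
  have e : degInt g Ω h = degInt g₀ Ω h := by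
    refine degInt_eq_of_lineMap_notMem hg hg₀ hΩ hΩo hh
      (isClosed_closedBall (x := y) (ε := r / 4)) (hhs.trans ball_subset_closedBall) ?_
    intro x hx t ht hmem
    have h1 := (convex_ball (f x) (r / 4)).lineMap_mem (mem_ball.2 (hgf x hx))
      (mem_ball.2 (hgf₀ x)) ht
    rw [mem_ball] at h1
    rw [mem_closedBall] at hmem
    have h2 := H x hx
    have := dist_triangle_left (f x) y (AffineMap.lineMap (g x) (g₀ x) t)
    linarith
  have := degInt_mul_integral_comm hg₀ hΩ hΩo hh hρ hhs hρs fun x hx => by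
    have h2 := H x hx
    have := dist_triangle_left (f x) y (g₀ x)
    linarith [hgf₀ x]
  rw [e, ← this, hρ1, mul_one]

/-- To compute the degree it suffices to use one good approximation at every scale. -/
theorem HasDeg.of_approx {f : E → E} (hf : Continuous f) {Ω : Set E} (hΩ : IsBounded Ω)
    (hΩo : IsOpen Ω) {y : E} (hy : y ∉ f '' frontier Ω) {d : ℝ}
    (H : ∀ δ > 0, ∃ g : E → E, ContDiff ℝ 1 g ∧ (∀ x ∈ frontier Ω, dist (g x) (f x) < δ) ∧
      ∃ h : E → ℝ, Continuous h ∧ Function.support h ⊆ ball y δ ∧ ∫ z, h z = 1 ∧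
        degInt g Ω h = d) : HasDeg f Ω y d := by
  obtain ⟨d', hd'⟩ := HasDeg.exists hf hΩ hΩo hy
  obtain ⟨δ, hδ, H'⟩ := id hd'
  obtain ⟨g, hg, hgf, h, hh, hhs, h1, e⟩ := H δ hδ
  have := H' g hg hgf h hh hhs
  rw [h1, mul_one, e] at this
  rwa [this]

theorem HasDeg.eventually {f : E → E} {Ω : Set E} {y : E} {d : ℝ} (h : HasDeg f Ω y d) :
    ∀ᶠ y' in 𝓝 y, HasDeg f Ω y' d := by
  obtain ⟨δ, hδ, H⟩ := h
  filter_upwards [ball_mem_nhds y (half_pos hδ)] with y' hy'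
  refine ⟨δ / 2, half_pos hδ, fun g hg hgf h hh hhs =>
    H g hg (fun x hx => (hgf x hx).trans (half_lt_self hδ)) h hh (hhs.trans ?_)⟩
  exact ball_subset_ball' (by rw [mem_ball] at hy'; linarith)

theorem HasDeg.congr {f f' : E → E} {Ω : Set E} {y : E} {d : ℝ} (h : HasDeg f Ω y d)
    (hff' : EqOn f f' (frontier Ω)) : HasDeg f' Ω y d := by
  obtain ⟨δ, hδ, H⟩ := h
  exact ⟨δ, hδ, fun g hg hgf => H g hg fun x hx => by rw [hff' hx]; exact hgf x hx⟩

theorem HasDeg.homotopy {f f' : E → E} (hf : Continuous f) (hf' : Continuous f') {Ω : Set E}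
    (hΩ : IsBounded Ω) (hΩo : IsOpen Ω) {y : E} {d : ℝ} (h : HasDeg f Ω y d)
    (H : ∀ x ∈ frontier Ω, ∀ t ∈ Icc (0 : ℝ) 1, AffineMap.lineMap (f x) (f' x) t ≠ y) :
    HasDeg f' Ω y d := by
  obtain ⟨δ₀, hδ₀, Hd⟩ := h
  have hc : Continuous fun p : E × ℝ => AffineMap.lineMap (f p.1) (f' p.1) p.2 := by
    simp only [AffineMap.lineMap_apply_module]
    fun_prop
  obtain ⟨r, hr, Hr⟩ := exists_le_dist_of_notMem_image hc
    ((isCompact_frontier hΩ).prod (isCompact_Icc (a := (0 : ℝ)) (b := 1))) (y := y) (by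
      rintro ⟨⟨x, t⟩, ⟨hx, ht⟩, e⟩
      exact H x hx t ht e)
  refine HasDeg.of_approx hf' hΩ hΩo ?_ fun δ hδ => ?_
  · rintro ⟨x, hx, e⟩
    exact H x hx 1 (by simp) (by simpa using e)
  set ε := min (min δ δ₀) (r / 4)
  have hε : 0 < ε := by positivity
  have hεδ : ε ≤ δ := (min_le_left _ _).trans (min_le_left _ _)
  have hεδ₀ : ε ≤ δ₀ := (min_le_left _ _).trans (min_le_right _ _)
  have hεr : ε ≤ r / 4 := min_le_right _ _
  obtain ⟨g, hg, hgf⟩ := exists_contDiff_near hf hε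
  obtain ⟨g', hg', hgf'⟩ := exists_contDiff_near hf' hε
  obtain ⟨ρ, hρ, hρs, hρ1⟩ := exists_integral_eq_one y hε
  refine ⟨g', hg', fun x _ => (hgf' x).trans_le hεδ, ρ, hρ, hρs.trans (ball_subset_ball hεδ),
    hρ1, ?_⟩
  have e := Hd g hg (fun x _ => (hgf x).trans_le hεδ₀) ρ hρ (hρs.trans (ball_subset_ball hεδ₀))
  rw [hρ1, mul_one] at e
  rw [← e]
  refine (degInt_eq_of_lineMap_notMem hg hg' hΩ hΩo hρ
    (isClosed_closedBall (x := y) (ε := ε)) (hρs.trans ball_subset_closedBall) ?_).symm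
  intro x hx t ht hmem
  rw [mem_closedBall] at hmem
  have h1 : dist (AffineMap.lineMap (g x) (g' x) t) (AffineMap.lineMap (f x) (f' x) t) ≤ ε := by
    rw [dist_eq_norm]
    have : AffineMap.lineMap (g x) (g' x) t - AffineMap.lineMap (f x) (f' x) t =
        AffineMap.lineMap (g x - f x) (g' x - f' x) t := by
      simp only [AffineMap.lineMap_apply_module, smul_sub]; module
    rw [this, ← mem_closedBall_zero_iff]
    refine (convex_closedBall (0 : E) ε).lineMap_mem ?_ ?_ ht
    · rw [mem_closedBall_zero_iff, ← dist_eq_norm]; exact (hgf x).le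
    · rw [mem_closedBall_zero_iff, ← dist_eq_norm]; exact (hgf' x).le
  have h2 := Hr (x, t) ⟨hx, ht⟩
  have h3 := dist_triangle_left (AffineMap.lineMap (f x) (f' x) t) y
    (AffineMap.lineMap (g x) (g' x) t)
  dsimp only at h2
  linarith

theorem HasDeg.id_of_mem {Ω : Set E} (hΩ : IsBounded Ω) (hΩo : IsOpen Ω) {y : E} (hy : y ∈ Ω) :
    HasDeg (fun x => x) Ω y 1 := by
  obtain ⟨r, hr, hb⟩ := Metric.isOpen_iff.1 hΩo y hy
  refine HasDeg.of_approx continuous_id hΩ hΩo ?_ fun δ hδ => ?_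
  · rintro ⟨x, hx, rfl⟩
    exact hΩo.inter_frontier_eq.subset ⟨hy, hx⟩
  obtain ⟨ρ, hρ, hρs, hρ1⟩ := exists_integral_eq_one y (lt_min hδ hr)
  refine ⟨fun x => x, contDiff_id, fun x _ => by simpa using hδ, ρ, hρ,
    hρs.trans (ball_subset_ball (min_le_left _ _)), hρ1, ?_⟩
  have : ∀ x : E, (fderiv ℝ (fun x : E => x) x).det = 1 := fun x => by
    rw [fderiv_fun_id, ContinuousLinearMap.det]; simp
  simp only [degInt, this, mul_one]
  rw [setIntegral_eq_integral_of_forall_compl_eq_zero, hρ1]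
  intro x hx
  by_contra hne
  exact hx (hb (ball_subset_ball (min_le_right _ _) (hρs hne)))

theorem HasDeg.zero_of_notMem {f : E → E} (hf : Continuous f) {Ω : Set E} (hΩ : IsBounded Ω)
    (hΩo : IsOpen Ω) {y : E} (hy : y ∉ f '' closure Ω) : HasDeg f Ω y 0 := by
  obtain ⟨r, hr, H⟩ := exists_le_dist_of_notMem_image hf hΩ.isCompact_closure hy
  refine HasDeg.of_approx hf hΩ hΩo (fun h => hy (image_mono frontier_subset_closure h))
    fun δ hδ => ?_
  have hε : 0 < min δ (r / 2) := lt_min hδ (half_pos hr)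
  obtain ⟨g, hg, hgf⟩ := exists_contDiff_near hf hε
  obtain ⟨ρ, hρ, hρs, hρ1⟩ := exists_integral_eq_one y hε
  refine ⟨g, hg, fun x _ => (hgf x).trans_le (min_le_left _ _), ρ, hρ,
    hρs.trans (ball_subset_ball (min_le_left _ _)), hρ1, ?_⟩
  refine setIntegral_eq_zero_of_forall_eq_zero fun x hx => ?_
  suffices ρ (g x) = 0 by rw [this, zero_mul]
  by_contra hne
  have h1 := mem_ball.1 (hρs hne)
  have h2 := H x (subset_closure hx)
  have h3 := dist_triangle_left (f x) y (g x)
  have h4 := min_le_right δ (r / 2)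
  linarith [hgf x]

theorem HasDeg.add {f : E → E} (hf : Continuous f) {Ω Ω₁ Ω₂ : Set E} (hΩ : IsBounded Ω)
    (hΩo : IsOpen Ω) (ho₁ : IsOpen Ω₁) (ho₂ : IsOpen Ω₂) (hs₁ : Ω₁ ⊆ Ω) (hs₂ : Ω₂ ⊆ Ω)
    (hdisj : Disjoint Ω₁ Ω₂) {y : E} (hy : y ∉ f '' (closure Ω \ (Ω₁ ∪ Ω₂))) {d₁ d₂ : ℝ}
    (h₁ : HasDeg f Ω₁ y d₁) (h₂ : HasDeg f Ω₂ y d₂) : HasDeg f Ω y (d₁ + d₂) := by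
  obtain ⟨δ₁, hδ₁, H₁⟩ := h₁
  obtain ⟨δ₂, hδ₂, H₂⟩ := h₂
  obtain ⟨r, hr, H⟩ := exists_le_dist_of_notMem_image hf
    (hΩ.isCompact_closure.diff (ho₁.union ho₂)) hy
  refine HasDeg.of_approx hf hΩ hΩo (fun h => hy (image_mono (fun x hx => ?_) h)) fun δ hδ => ?_
  · refine ⟨frontier_subset_closure hx, fun hx' => ?_⟩
    exact hΩo.inter_frontier_eq.subset ⟨hx'.elim (fun h => hs₁ h) (fun h => hs₂ h), hx⟩
  set ε := min (min δ (r / 2)) (min δ₁ δ₂)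
  have hε : 0 < ε := by positivity
  have hεδ : ε ≤ δ := (min_le_left _ _).trans (min_le_left _ _)
  have hεr : ε ≤ r / 2 := (min_le_left _ _).trans (min_le_right _ _)
  have hε₁ : ε ≤ δ₁ := (min_le_right _ _).trans (min_le_left _ _)
  have hε₂ : ε ≤ δ₂ := (min_le_right _ _).trans (min_le_right _ _)
  obtain ⟨g, hg, hgf⟩ := exists_contDiff_near hf hε
  obtain ⟨ρ, hρ, hρs, hρ1⟩ := exists_integral_eq_one y hε
  refine ⟨g, hg, fun x _ => (hgf x).trans_le hεδ, ρ, hρ, hρs.trans (ball_subset_ball hεδ),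
    hρ1, ?_⟩
  have e₁ := H₁ g hg (fun x _ => (hgf x).trans_le hε₁) ρ hρ (hρs.trans (ball_subset_ball hε₁))
  have e₂ := H₂ g hg (fun x _ => (hgf x).trans_le hε₂) ρ hρ (hρs.trans (ball_subset_ball hε₂))
  rw [hρ1, mul_one] at e₁ e₂
  have hcont : Continuous fun x => ρ (g x) * (fderiv ℝ g x).det :=
    (hρ.comp hg.continuous).mul (continuous_det_fderiv hg)
  rw [← e₁, ← e₂, degInt, degInt, degInt, ← setIntegral_union hdisj ho₂.measurableSet
    (integrableOn_of_continuous hcont (hΩ.subset hs₁))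
    (integrableOn_of_continuous hcont (hΩ.subset hs₂))]
  refine setIntegral_eq_of_subset_of_forall_sdiff_eq_zero hΩo.measurableSet
    (union_subset hs₁ hs₂) fun x hx => ?_
  suffices ρ (g x) = 0 by rw [this, zero_mul]
  by_contra hne
  have h1 := mem_ball.1 (hρs hne)
  have h2 := H x ⟨subset_closure hx.1, hx.2⟩
  have h3 := dist_triangle_left (f x) y (g x)
  linarith [hgf x]

theorem HasDeg.of_isPreconnected {f : E → E} (hf : Continuous f) {Ω : Set E} (hΩ : IsBounded Ω)
    (hΩo : IsOpen Ω) {C : Set E} (hC : IsPreconnected C) (hCf : Disjoint C (f '' frontier Ω))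
    {y y' : E} (hy : y ∈ C) (hy' : y' ∈ C) {d : ℝ} (h : HasDeg f Ω y d) : HasDeg f Ω y' d := by
  refine hC.induction₂' (fun a b => HasDeg f Ω a d → HasDeg f Ω b d) ?_ ?_ hy hy' h
  · intro a ha
    obtain ⟨e, he⟩ := HasDeg.exists hf hΩ hΩo (disjoint_left.1 hCf ha)
    filter_upwards [nhdsWithin_le_nhds he.eventually] with b hb
    constructor
    · intro h'; rwa [h'.unique hf he]
    · intro h'; rwa [h'.unique hf hb]
  · intro a b c _ _ _ hab hbc h'
    exact hbc (hab h')

end Degree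

section Comp

variable {E : Type*} [NormedAddCommGroup E] [InnerProductSpace ℝ E] [FiniteDimensional ℝ E]
  [MeasurableSpace E] [BorelSpace E]

/-- Weights supported in a compact set on which the degree is a locally constant function `m`
are integrated against `m`. -/
theorem exists_forall_degInt_eq_integral {f : E → E} {Ω : Set E} (hΩ : IsBounded Ω)
    {K : Set E} (hK : IsCompact K) {m : E → ℝ}
    (hm : ∀ z ∈ K, HasDeg f Ω z (m z) ∧ ∀ᶠ z' in 𝓝 z, m z' = m z) :
    ∃ δ > 0, ∀ f₁ : E → E, ContDiff ℝ 1 f₁ → (∀ x ∈ frontier Ω, dist (f₁ x) (f x) < δ) →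
      ∀ k : E → ℝ, Continuous k → Function.support k ⊆ K →
        degInt f₁ Ω k = ∫ z, m z * k z := by
  have hloc : ∀ z ∈ K, ∃ δ > 0, (∀ z' ∈ ball z δ, m z' = m z) ∧
      ∀ f₁ : E → E, ContDiff ℝ 1 f₁ → (∀ x ∈ frontier Ω, dist (f₁ x) (f x) < δ) →
      ∀ k : E → ℝ, Continuous k → Function.support k ⊆ ball z δ →
        degInt f₁ Ω k = m z * ∫ z, k z := by
    intro z hz
    obtain ⟨⟨δ, hδ, H⟩, hmz⟩ := hm z hz
    obtain ⟨ε, hε, hmε⟩ := Metric.eventually_nhds_iff_ball.1 hmz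
    refine ⟨min δ ε, lt_min hδ hε, fun z' hz' => hmε z' (ball_subset_ball (min_le_right _ _) hz'),
      fun f₁ h₁ hf₁ k hk hks => H f₁ h₁ (fun x hx => (hf₁ x hx).trans_le (min_le_left _ _)) k hk
        (hks.trans (ball_subset_ball (min_le_left _ _)))⟩
  choose! δ hδ hmδ hdeg using hloc
  obtain ⟨t, htK, ht⟩ := hK.elim_nhds_subcover (fun z => ball z (δ z))
    fun z hz => ball_mem_nhds z (hδ z hz)
  obtain ⟨ρ, hρ⟩ := PartitionOfUnity.exists_isSubordinate hK.isClosed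
    (fun i : t => ball (i : E) (δ i)) (fun i => isOpen_ball) (by simpa [iUnion_subtype] using ht)
  obtain ⟨δ₀, hδ₀, hδt⟩ : ∃ δ₀ > 0, ∀ z ∈ t, δ₀ ≤ δ z := by
    rcases t.eq_empty_or_nonempty with rfl | hne
    · exact ⟨1, one_pos, by simp⟩
    · obtain ⟨z, hz, hmin⟩ := t.exists_min_image δ hne
      exact ⟨δ z, hδ z (htK z hz), hmin⟩
  refine ⟨δ₀, hδ₀, fun f₁ h₁ hf₁ k hk hks => ?_⟩
  have hsum : ∀ z, k z = ∑ i, ρ i z * k z := by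
    intro z
    by_cases hz : k z = 0
    · simp [hz]
    · rw [← Finset.sum_mul, ← finsum_eq_sum_of_fintype, ρ.sum_eq_one (hks hz), one_mul]
  have hc : ∀ i, Continuous fun z => ρ i z * k z := fun i => (ρ i).continuous.mul hk
  have hs : ∀ i, Function.support (fun z => ρ i z * k z) ⊆ ball (i : E) (δ i) := fun i z hz =>
    hρ i (subset_tsupport _ (left_ne_zero_of_mul hz))
  have hd := continuous_det_fderiv h₁
  have e₁ : degInt f₁ Ω k = ∑ i, degInt f₁ Ω fun z => ρ i z * k z := by
    simp only [degInt]
    rw [← integral_finsetSum Finset.univ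
      (f := fun (i : t) x => ρ i (f₁ x) * k (f₁ x) * (fderiv ℝ f₁ x).det)
      fun i _ => integrableOn_of_continuous (((hc i).comp h₁.continuous).mul hd) hΩ]
    congr 1 with x
    rw [← Finset.sum_mul, ← hsum]
  have e₂ : ∀ z, m z * k z = ∑ i : t, m i * (ρ i z * k z) := by
    intro z
    rw [hsum z, Finset.mul_sum]
    refine Finset.sum_congr rfl fun i _ => ?_
    rw [← hsum z]
    by_cases hz : ρ i z * k z = 0
    · simp [hz]
    · rw [hmδ i (htK i i.2) z (hs i hz)]
  simp only [e₂]
  rw [e₁, integral_finsetSum _ fun i _ => ?_]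
  · refine Finset.sum_congr rfl fun i _ => ?_
    rw [integral_const_mul]
    exact hdeg i (htK i i.2) f₁ h₁ (fun x hx => (hf₁ x hx).trans_le (hδt i i.2)) _ (hc i) (hs i)
  · refine ((hc i).integrable_of_hasCompactSupport ?_).const_mul _
    exact HasCompactSupport.of_support_subset_isCompact hK fun z hz =>
      hks (right_ne_zero_of_mul hz)

theorem degInt_comp {f g : E → E} (hf : ContDiff ℝ 1 f) (hg : ContDiff ℝ 1 g) (Ω : Set E)
    (h : E → ℝ) :
    degInt (fun x => g (f x)) Ω h = degInt f Ω fun z => h (g z) * (fderiv ℝ g z).det := by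
  have : ∀ x, (fderiv ℝ (fun x => g (f x)) x).det =
      (fderiv ℝ g (f x)).det * (fderiv ℝ f x).det := by
    intro x
    rw [fderiv_fun_comp x (hg.differentiable one_ne_zero _) (hf.differentiable one_ne_zero _)]
    exact LinearMap.det_comp _ _
  simp only [degInt, this, mul_assoc]

/-- A case of the product formula for the degree of a composition. -/
theorem HasDeg.comp {f g : E → E} (hf : Continuous f) (hg : Continuous g) {Ω Ω' : Set E}
    (hΩ : IsBounded Ω) (hΩo : IsOpen Ω) (hΩ' : IsBounded Ω') (hΩo' : IsOpen Ω') {y : E}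
    (hy : y ∉ (fun x => g (f x)) '' frontier Ω) (hy' : y ∉ g '' frontier Ω') {κ e : ℝ}
    (h₁ : ∀ z ∈ Ω', g z = y → HasDeg f Ω z κ) (h₀ : ∀ z ∉ Ω', g z = y → HasDeg f Ω z 0)
    (he : HasDeg g Ω' y e) : HasDeg (fun x => g (f x)) Ω y (κ * e) := by
  classical
  obtain ⟨R, hR, hRb⟩ := (((hΩ.isCompact_closure.image hf).isBounded.cthickening
    (δ := 1)).union hΩ').subset_closedBall_lt 0 0
  obtain ⟨hRf, hRΩ'⟩ := union_subset_iff.1 hRb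
  set m : E → ℝ := Ω'.indicator fun _ => κ with hm
  set V : Set E := interior {z | HasDeg f Ω z (m z) ∧ ∀ᶠ z' in 𝓝 z, m z' = m z} with hV
  have hgV : ∀ z, g z = y → z ∈ V := by
    intro z hz
    have key : ∀ c, HasDeg f Ω z c → (∀ᶠ z' in 𝓝 z, m z' = c) → z ∈ V := by
      intro c hc hmc
      rw [hV, mem_interior_iff_mem_nhds]
      filter_upwards [hc.eventually, hmc, hmc.eventually_nhds] with a h1 h2 h3
      simp only [h2]
      exact ⟨h1, h3⟩
    by_cases hzΩ : z ∈ Ω'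
    · refine key κ (h₁ z hzΩ hz) ?_
      filter_upwards [hΩo'.mem_nhds hzΩ] with a ha using indicator_of_mem ha _
    · refine key 0 (h₀ z hzΩ hz) ?_
      have : z ∉ closure Ω' := fun hc => hy' ⟨z, ⟨hc, fun hi => hzΩ (interior_subset hi)⟩, hz⟩
      filter_upwards [isClosed_closure.isOpen_compl.mem_nhds this] with a ha
      exact indicator_of_notMem (fun h => ha (subset_closure h)) _
  obtain ⟨r, hr, Hr⟩ := exists_le_dist_of_notMem_image hg
    ((isCompact_closedBall (0 : E) (R + 1)).diff isOpen_interior) (y := y) (by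
      rintro ⟨z, ⟨-, hz⟩, e⟩
      exact hz (hgV z e))
  set K := closedBall (0 : E) (R + 1) ∩ g ⁻¹' closedBall y (r / 2) with hKdef
  have hK : IsCompact K :=
    (isCompact_closedBall _ _).inter_right (isClosed_closedBall.preimage hg)
  have hKm : ∀ z ∈ K, HasDeg f Ω z (m z) ∧ ∀ᶠ z' in 𝓝 z, m z' = m z := by
    rintro z ⟨hz, hzg⟩
    have hzV : z ∈ V := by
      by_contra hzV
      have := Hr z ⟨hz, hzV⟩
      have h2 : dist (g z) y ≤ r / 2 := hzg
      linarith
    exact (interior_subset : V ⊆ {z | HasDeg f Ω z (m z) ∧ ∀ᶠ z' in 𝓝 z, m z' = m z}) hzV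
  obtain ⟨δ₁, hδ₁, H₁⟩ := exists_forall_degInt_eq_integral hΩ hK hKm
  obtain ⟨δ₂, hδ₂, H₂⟩ := he
  refine HasDeg.of_approx (hg.comp hf) hΩ hΩo hy fun δ hδ => ?_
  obtain ⟨δ₃, hδ₃, H₃⟩ := Metric.uniformContinuousOn_iff.1
    ((isCompact_closedBall (0 : E) R).uniformContinuousOn_of_continuous hg.continuousOn)
    (δ / 2) (half_pos hδ)
  obtain ⟨g₁, hg₁, hgg₁⟩ := exists_contDiff_near hg (δ := min (δ / 2) (min (r / 4) δ₂))
    (by positivity)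
  obtain ⟨f₁, hf₁, hff₁⟩ := exists_contDiff_near hf (δ := min (min 1 δ₁) δ₃) (by positivity)
  obtain ⟨h, hh, hhs, hh1⟩ := exists_integral_eq_one y (δ := min δ (min (r / 4) δ₂))
    (by positivity)
  simp only [lt_min_iff] at hgg₁ hff₁
  have hhs' : ∀ {z}, h z ≠ 0 → dist z y < δ ∧ dist z y < r / 4 ∧ dist z y < δ₂ := by
    intro z hz
    simpa only [mem_ball, lt_min_iff] using hhs hz
  have hfR : ∀ x ∈ closure Ω, f x ∈ closedBall 0 R := fun x hx =>
    hRf (self_subset_cthickening _ (mem_image_of_mem f hx))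
  have hf₁R : ∀ x ∈ closure Ω, f₁ x ∈ closedBall 0 R := fun x hx =>
    hRf (mem_cthickening_of_dist_le _ (f x) _ _ (mem_image_of_mem f hx) (hff₁ x).1.1.le)
  refine ⟨fun x => g₁ (f₁ x), hg₁.comp hf₁, fun x hx => ?_, h, hh, fun z hz => (hhs' hz).1, hh1, ?_⟩
  · have h1 := (hgg₁ (f₁ x)).1
    have h2 := H₃ (f₁ x) (hf₁R x (frontier_subset_closure hx)) (f x)
      (hfR x (frontier_subset_closure hx)) (hff₁ x).2
    exact (dist_triangle (g₁ (f₁ x)) (g (f₁ x)) (g (f x))).trans_lt (by linarith)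
  · let θ : ContDiffBump (0 : E) := ⟨R, R + 1, hR, by linarith⟩
    have hθ : ∀ z ∈ closedBall (0 : E) R, θ z = 1 := fun z hz => θ.one_of_mem_closedBall hz
    set k : E → ℝ := fun z => θ z * (h (g₁ z) * (fderiv ℝ g₁ z).det) with hk
    have hkc : Continuous k := θ.continuous.mul
      ((hh.comp hg₁.continuous).mul (continuous_det_fderiv hg₁))
    have hks : Function.support k ⊆ K := by
      intro z hz
      refine ⟨?_, ?_⟩
      · have := subset_tsupport _ (show z ∈ Function.support θ from left_ne_zero_of_mul hz)
        rwa [θ.tsupport_eq] at this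
      · have h1 := (hhs' (left_ne_zero_of_mul (right_ne_zero_of_mul hz))).2.1
        have h2 := (hgg₁ z).2.1
        rw [mem_preimage, mem_closedBall]
        linarith [dist_triangle_left (g z) y (g₁ z)]
    have e₁ : degInt (fun x => g₁ (f₁ x)) Ω h = degInt f₁ Ω k := by
      rw [degInt_comp hf₁ hg₁]
      refine setIntegral_congr_fun hΩo.measurableSet fun x hx => ?_
      simp only [hk, hθ _ (hf₁R x (subset_closure hx)), one_mul]
    rw [e₁, H₁ f₁ hf₁ (fun x _ => (hff₁ x).1.2) k hkc hks]
    have e₂ : ∫ z, m z * k z = ∫ z, Ω'.indicator (fun z => κ * k z) z := by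
      congr 1 with z
      by_cases hz : z ∈ Ω' <;> simp [hm, hz]
    have e₃ := H₂ g₁ hg₁ (fun x _ => (hgg₁ x).2.2) h hh fun z hz => (hhs' hz).2.2
    rw [hh1, mul_one] at e₃
    rw [e₂, integral_indicator hΩo'.measurableSet, integral_const_mul, ← e₃]
    congr 1
    refine setIntegral_congr_fun hΩo'.measurableSet fun z hz => ?_
    simp only [hk, hθ z (hRΩ' hz), one_mul]

end Comp

section Topology

/-- A function constant on the fibres of a closed map to `E` factors through a continuous map
defined on the whole space. -/
theorem exists_continuous_factor {E : Type*} [NormedAddCommGroup E] [NormedSpace ℝ E]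
    [FiniteDimensional ℝ E] {Z : Type*} [TopologicalSpace Z] {p : Z → E} (hp : Continuous p)
    (hpc : IsClosedMap p) {c : Z → E} (hc : Continuous c) (h : ∀ a b, p a = p b → c a = c b) :
    ∃ ψ : E → E, Continuous ψ ∧ ∀ z, ψ (p z) = c z := by
  have hq : IsQuotientMap (rangeFactorization p) :=
    (IsClosedMap.codRestrict hpc mem_range_self).isQuotientMap
      (hp.subtype_mk _) rangeFactorization_surjective
  choose s hs using fun y : range p => y.2
  have hsc : ∀ z, c (s (rangeFactorization p z)) = c z := fun z => h _ _ (hs _)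
  have hcont : Continuous fun y => c (s y) := by
    rw [hq.continuous_iff]
    exact hc.congr fun z => (hsc z).symm
  obtain ⟨ψ, hψ⟩ := ContinuousMap.exists_restrict_eq hpc.isClosed_range ⟨_, hcont⟩
  refine ⟨ψ, ψ.continuous, fun z => ?_⟩
  have := DFunLike.congr_fun hψ (rangeFactorization p z)
  exact this.trans (hsc z)

theorem isPreconnected_lt_norm {E : Type*} [NormedAddCommGroup E] [NormedSpace ℝ E]
    (hE : 1 < Module.rank ℝ E) {R : ℝ} (hR : 0 ≤ R) : IsPreconnected {x : E | R < ‖x‖} := by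
  have : {x : E | R < ‖x‖} = (fun p : ℝ × E => p.1 • p.2) '' (Ioi R ×ˢ sphere (0 : E) 1) := by
    ext x
    constructor
    · intro hx
      have hx0 : 0 < ‖x‖ := hR.trans_lt hx
      refine ⟨(‖x‖, ‖x‖⁻¹ • x), ⟨hx, ?_⟩, ?_⟩
      · simp [norm_smul, hx0.ne']
      · simp [smul_smul, hx0.ne']
    · rintro ⟨⟨t, y⟩, ⟨ht, hy⟩, rfl⟩
      have ht' : R < t := ht
      have : ‖y‖ = 1 := by simpa using hy
      change R < ‖t • y‖
      rwa [norm_smul, this, mul_one, Real.norm_of_nonneg (hR.trans ht'.le)]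
  rw [this]
  exact (isPreconnected_Ioi.prod (isPreconnected_sphere hE 0 1)).image _
    (by fun_prop : Continuous fun p : ℝ × E => p.1 • p.2).continuousOn

theorem connectedComponentIn_eq_of_not_isBounded {E : Type*} [NormedAddCommGroup E]
    [NormedSpace ℝ E] (hE : 1 < Module.rank ℝ E) {X : Set E} (hX : IsBounded X) {a b : E}
    (ha : ¬ IsBounded (connectedComponentIn Xᶜ a)) (hb : ¬ IsBounded (connectedComponentIn Xᶜ b)) :
    connectedComponentIn Xᶜ a = connectedComponentIn Xᶜ b := by
  obtain ⟨R, hR, hXR⟩ := hX.subset_closedBall_lt 0 0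
  have hsub : {x : E | R < ‖x‖} ⊆ Xᶜ := fun x hx hxX => by
    have h1 := hXR hxX
    rw [mem_closedBall_zero_iff] at h1
    exact absurd h1 (not_le.2 hx)
  have key : ∀ c, ¬ IsBounded (connectedComponentIn Xᶜ c) →
      ∃ z, R < ‖z‖ ∧ connectedComponentIn Xᶜ c = connectedComponentIn Xᶜ z := by
    intro c hc
    by_contra! hcon
    refine hc ((isBounded_closedBall (x := (0 : E)) (r := R)).subset fun z hz => ?_)
    by_contra hz'
    rw [mem_closedBall_zero_iff, not_le] at hz'
    exact hcon z hz' (connectedComponentIn_eq hz)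
  obtain ⟨z, hz, ez⟩ := key a ha
  obtain ⟨z', hz', ez'⟩ := key b hb
  rw [ez, ez']
  exact connectedComponentIn_eq ((isPreconnected_lt_norm hE hR.le).subset_connectedComponentIn
    hz hsub hz')

theorem frontier_connectedComponentIn_subset {E : Type*} [TopologicalSpace E]
    [LocallyConnectedSpace E] {X : Set E} (hX : IsClosed X) (a : E) :
    frontier (connectedComponentIn Xᶜ a) ⊆ X := by
  intro x hx
  by_contra hxX
  have ho : IsOpen (connectedComponentIn Xᶜ x) := hX.isOpen_compl.connectedComponentIn
  obtain ⟨z, hz, hz'⟩ := mem_closure_iff.1 hx.1 _ ho (mem_connectedComponentIn hxX)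
  have e : connectedComponentIn Xᶜ a = connectedComponentIn Xᶜ x :=
    (connectedComponentIn_eq hz').trans (connectedComponentIn_eq hz).symm
  refine hx.2 ?_
  rw [e, ho.interior_eq]
  exact mem_connectedComponentIn hxX

end Topology

section Sphere

variable {E : Type*} [NormedAddCommGroup E] [NormedSpace ℝ E]

theorem eq_of_smul_eq_smul_of_norm_eq {x q : E} (hx : ‖x‖ = 1) (hq : ‖q‖ = 1) {α β : ℝ}
    (hα : 0 ≤ α) (hβ : 0 ≤ β) (h : α • x = β • q) : α = β ∧ (α ≠ 0 → x = q) := by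
  have e : α = β := by
    have := congrArg norm h
    rwa [norm_smul, norm_smul, hx, hq, mul_one, mul_one, Real.norm_of_nonneg hα,
      Real.norm_of_nonneg hβ] at this
  subst e
  exact ⟨rfl, fun h0 => smul_right_injective E h0 h⟩

/-- A self-map of the sphere, homotopic to the identity, which is the identity near `q` and
collapses the complement of a neighbourhood of `q` to `-q`. -/
theorem exists_sphere_collapse (q : sphere (0 : E) 1) {U : Set (sphere (0 : E) 1)}
    (hU : U ∈ 𝓝 q) : ∃ c : sphere (0 : E) 1 → E, Continuous c ∧ (∀ x, ‖c x‖ = 1) ∧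
      (∀ᶠ x in 𝓝 q, c x = x) ∧ (∀ x ∉ U, c x = -q) ∧ (∀ x, c x = q → x = q) ∧
      ∀ x : sphere (0 : E) 1, ∀ t ∈ Icc (0 : ℝ) 1, AffineMap.lineMap (x : E) (c x) t ≠ 0 := by
  have hn : ∀ x : sphere (0 : E) 1, ‖(x : E)‖ = 1 := fun x => by simp
  obtain ⟨V, hV, hVc, hVU⟩ := exists_mem_nhds_isClosed_subset (interior_mem_nhds.2 hU)
  obtain ⟨s, hs0, hs1, hsI⟩ := exists_continuous_zero_one_of_isClosed hVc
    isOpen_interior.isClosed_compl (disjoint_compl_right_iff_subset.2 hVU)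
  have hs0' : ∀ x ∈ V, s x = 0 := fun x hx => hs0 hx
  have hsq : s q = 0 := hs0' q (mem_of_mem_nhds hV)
  have hs0I : ∀ x, 0 ≤ s x := fun x => (hsI x).1
  have hs1I : ∀ x, 0 ≤ 1 - s x := fun x => sub_nonneg.2 (hsI x).2
  set v : sphere (0 : E) 1 → E := fun x => (1 - s x) • (x : E) - s x • (q : E) with hv
  have hvc : Continuous v := by fun_prop
  have hv0 : ∀ x, 0 < ‖v x‖ := by
    intro x
    rw [norm_pos_iff]
    intro h
    obtain ⟨h1, h2⟩ := eq_of_smul_eq_smul_of_norm_eq (hn x) (hn q) (hs1I x) (hs0I x)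
      (sub_eq_zero.1 h)
    have h3 : x = q := Subtype.ext (h2 (by linarith))
    rw [h3, hsq] at h1
    norm_num at h1
  refine ⟨fun x => ‖v x‖⁻¹ • v x, (hvc.norm.inv₀ fun x => (hv0 x).ne').smul hvc, fun x => ?_, ?_,
    fun x hx => ?_, fun x hx => ?_, fun x t ht h => ?_⟩
  · rw [norm_smul, norm_inv, norm_norm, inv_mul_cancel₀ (hv0 x).ne']
  · filter_upwards [hV] with x hx
    have : v x = x := by simp [hv, hs0' x hx]
    simp only [this, hn x, inv_one, one_smul]
  · have h1 : s x = 1 := hs1 fun h => hx (interior_subset h)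
    have : v x = -q := by simp [hv, h1]
    simp only [this, norm_neg, hn q, inv_one, one_smul]
  · rw [inv_smul_eq_iff₀ (hv0 x).ne'] at hx
    have h1 : (1 - s x) • (x : E) = (‖v x‖ + s x) • (q : E) := by
      rw [add_smul, ← hx]; simp [hv]
    have h2 : 0 ≤ ‖v x‖ + s x := add_nonneg (hv0 x).le (hs0I x)
    obtain ⟨h3, h4⟩ := eq_of_smul_eq_smul_of_norm_eq (hn x) (hn q) (hs1I x) h2 h1
    exact Subtype.ext (h4 (by linarith [hv0 x, hs0I x]))
  · rw [AffineMap.lineMap_apply_module] at h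
    have hi : 0 < ‖v x‖⁻¹ := inv_pos.2 (hv0 x)
    have ht' : 0 ≤ 1 - t := by linarith [ht.2]
    have h1 : (1 - t + t * ‖v x‖⁻¹ * (1 - s x)) • (x : E) = (t * ‖v x‖⁻¹ * s x) • (q : E) := by
      refine sub_eq_zero.1 (Eq.trans ?_ h)
      simp only [hv]
      module
    have hti : 0 ≤ t * ‖v x‖⁻¹ := mul_nonneg ht.1 hi.le
    obtain ⟨h3, h4⟩ := eq_of_smul_eq_smul_of_norm_eq (hn x) (hn q)
      (add_nonneg ht' (mul_nonneg hti (hs1I x))) (mul_nonneg hti (hs0I x)) h1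
    by_cases h0 : 1 - t + t * ‖v x‖⁻¹ * (1 - s x) = 0
    · have a1 := mul_nonneg hti (hs1I x)
      have a2 : t = 1 := by linarith
      rw [a2] at h0 h3
      have a3 : ‖v x‖⁻¹ * (1 - s x) = 0 := by linarith
      have a4 : ‖v x‖⁻¹ * s x = 0 := by linarith
      rcases mul_eq_zero.1 a3 with a | a
      · exact hi.ne' a
      rcases mul_eq_zero.1 a4 with b | b
      · exact hi.ne' b
      linarith
    · have h5 : x = q := Subtype.ext (h4 h0)
      have h6 : s x = 0 := by rw [h5, hsq]
      exact h0 (by rw [h3, h6, mul_zero])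

/-- Radial extension of a map on the closed unit ball. -/
theorem exists_radial_extension {F : closedBall (0 : E) 1 → E} (hF : Continuous F) :
    ∃ φ : E → E, Continuous φ ∧ (∀ x : closedBall (0 : E) 1, φ x = F x) ∧
      (∀ z, φ z ∈ range F) ∧ ∀ z ∉ ball (0 : E) 1, ∃ x : sphere (0 : E) 1, φ z = φ x := by
  have hpos : ∀ z : E, 0 < max 1 ‖z‖ := fun z => lt_max_of_lt_left one_pos
  have hmem : ∀ z : E, (max 1 ‖z‖)⁻¹ • z ∈ closedBall (0 : E) 1 := by
    intro z
    rw [mem_closedBall_zero_iff, norm_smul, norm_inv, Real.norm_of_nonneg (hpos z).le,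
      inv_mul_le_iff₀ (hpos z), mul_one]
    exact le_max_right _ _
  have hφ : ∀ x : closedBall (0 : E) 1, F ⟨_, hmem x⟩ = F x := by
    intro x
    congr 1
    ext1
    have : ‖(x : E)‖ ≤ 1 := mem_closedBall_zero_iff.1 x.2
    simp [max_eq_left this]
  refine ⟨fun z => F ⟨_, hmem z⟩, ?_, hφ, fun z => mem_range_self _, fun z hz => ?_⟩
  · refine hF.comp (Continuous.subtype_mk ?_ _)
    exact ((continuous_const.max continuous_norm).inv₀ fun z => (hpos z).ne').smul continuous_id
  · rw [mem_ball_zero_iff, not_lt] at hz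
    have hs : (max 1 ‖z‖)⁻¹ • z ∈ sphere (0 : E) 1 := by
      rw [mem_sphere_zero_iff_norm, norm_smul, max_eq_right hz, norm_inv, norm_norm,
        inv_mul_cancel₀ (by linarith)]
    exact ⟨⟨_, hs⟩, (hφ ⟨_, hmem z⟩).symm⟩

end Sphere

section Separation

variable {E : Type*} [NormedAddCommGroup E] [InnerProductSpace ℝ E] [FiniteDimensional ℝ E]
  [MeasurableSpace E] [BorelSpace E]

/-- Near an injectivity point `q`, the degree function `w` of `φ` on the unit ball differs across
a bounded domain `G` bounded by the image of the sphere. -/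
theorem exists_degree_relation {φ : E → E} (hφ : Continuous φ)
    (hout : ∀ z ∉ ball (0 : E) 1, ∃ x : sphere (0 : E) 1, φ z = φ x)
    {U : Set (sphere (0 : E) 1)} {q : sphere (0 : E) 1} (hU : U ∈ 𝓝 q)
    (hinj : ∀ p ∈ U, ∀ x : sphere (0 : E) 1, φ x = φ p → x = p) {w : E → ℝ}
    (hw : ∀ y ∉ φ '' sphere 0 1, HasDeg φ (ball 0 1) y (w y)) :
    ∃ r > 0, ∀ G : Set E, IsBounded G → IsOpen G → frontier G ⊆ φ '' sphere 0 1 →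
      ∃ u d : ℝ, ∀ a ∈ ball (φ q) r \ φ '' sphere 0 1, u * w a = G.indicator 1 a + d := by
  obtain ⟨c, hc, hcn, hcq, hcU, hcq', -⟩ := exists_sphere_collapse q hU
  have hcs : ∀ x, c x ∈ sphere (0 : E) 1 := fun x => by simpa using hcn x
  obtain ⟨N, hN, hNo, hqN⟩ := _root_.eventually_nhds_iff.1 hcq
  have hNc : IsCompact Nᶜ := hNo.isClosed_compl.isCompact
  have hqU : q ∈ U := mem_of_mem_nhds hU
  have hfib : ∀ x y : sphere (0 : E) 1, φ x = φ y → c x = c y := by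
    intro x y hxy
    by_cases hx : x ∈ U
    · rw [hinj x hx y hxy.symm]
    by_cases hy : y ∈ U
    · rw [hinj y hy x hxy]
    rw [hcU x hx, hcU y hy]
  have hφs : Continuous fun x : sphere (0 : E) 1 => φ x := by fun_prop
  obtain ⟨ψ, hψ, hψc⟩ := exists_continuous_factor hφs hφs.isClosedMap hc hfib
  obtain ⟨r₁, hr₁, H₁⟩ := exists_le_dist_of_notMem_image (hφ.comp hc) hNc (y := φ q) (by
    rintro ⟨x, hx, e⟩
    have : (⟨c x, hcs x⟩ : sphere (0 : E) 1) = q := hinj q hqU _ e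
    exact hx (hcq' x (congrArg Subtype.val this) ▸ hqN))
  obtain ⟨r₂, hr₂, H₂⟩ := exists_le_dist_of_notMem_image hφs hNc (y := φ q) (by
    rintro ⟨x, hx, e⟩
    exact hx (hinj q hqU _ e ▸ hqN))
  set ρ := r₂ / 2 with hρ
  have hρ0 : 0 < ρ := half_pos hr₂
  set r := min r₁ ρ
  have hr0 : 0 < r := by positivity
  obtain ⟨H, hH, HZ⟩ := exists_continuous_factor
    (Z := sphere (0 : E) 1 ⊕ closedBall (φ q) ρ) (p := Sum.elim (fun x => φ x) Subtype.val)
    (c := Sum.elim (fun x => φ (c x)) Subtype.val)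
    (hφs.sumElim continuous_subtype_val) (Continuous.isClosedMap (hφs.sumElim continuous_subtype_val))
    ((hφ.comp hc).sumElim continuous_subtype_val) (by
      have key : ∀ (x : sphere (0 : E) 1) (z : closedBall (φ q) ρ), φ x = z → φ (c x) = z := by
        intro x z hxz
        have hxN : x ∈ N := by
          by_contra hxN
          have h1 := H₂ x hxN
          have h2 : dist (z : E) (φ q) ≤ ρ := z.2
          rw [← hxz] at h2
          linarith
        rw [hN x hxN, hxz]
      rintro (x | z) (y | z') h
      · exact congrArg φ (hfib x y h)
      · exact key x z' h
      · exact (key y z h.symm).symm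
      · exact h)
  have Hs : ∀ x : sphere (0 : E) 1, H (φ x) = φ (c x) := fun x => HZ (.inl x)
  have Hb : ∀ z ∈ closedBall (φ q) ρ, H z = z := fun z hz => HZ (.inr ⟨z, hz⟩)
  have Hfar : ∀ z ∈ φ '' sphere 0 1, z ∉ ball (φ q) ρ → H z ∉ ball (φ q) r := by
    rintro z ⟨x, hx, rfl⟩ hz h
    lift x to sphere (0 : E) 1 using hx
    by_cases hxN : x ∈ N
    · rw [Hs, hN x hxN] at h
      exact hz (ball_subset_ball (min_le_right _ _) h)
    · rw [Hs] at h
      have h1 := H₁ x hxN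
      have h2 : dist (φ (c x)) (φ q) < r := h
      have h3 : r ≤ r₁ := min_le_left _ _
      exact absurd h1 (not_le.2 (h2.trans_le h3))
  have HX : ∀ z ∈ φ '' sphere 0 1, H z ∈ φ '' sphere 0 1 := by
    rintro z ⟨x, hx, rfl⟩
    lift x to sphere (0 : E) 1 using hx
    rw [Hs]
    exact mem_image_of_mem φ (hcs x)
  have hfs : frontier (ball (0 : E) 1) = sphere 0 1 := frontier_ball 0 one_ne_zero
  refine ⟨r, hr0, fun G hG hGo hGX => ?_⟩
  have hψG : ∀ z ∈ frontier G, ψ z ∈ sphere (0 : E) 1 := by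
    intro z hz
    obtain ⟨x, hx, rfl⟩ := hGX hz
    rw [hψc ⟨x, hx⟩]
    exact hcs _
  obtain ⟨u, hu⟩ := HasDeg.exists hψ hG hGo (y := 0) (by
    rintro ⟨z, hz, e⟩
    have := hψG z hz
    rw [e] at this
    simp at this)
  have hu' : ∀ z ∈ ball (0 : E) 1, HasDeg ψ G z u := fun z hz =>
    hu.of_isPreconnected hψ hG hGo (convex_ball (0 : E) 1).isPreconnected
      (disjoint_left.2 (by
        rintro _ hy ⟨z, hz, rfl⟩
        have h1 := hψG z hz
        rw [mem_sphere] at h1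
        rw [mem_ball, h1] at hy
        exact lt_irrefl _ hy)) (mem_ball_self one_pos) hz
  have hG₂ : IsOpen (G \ closedBall (φ q) ρ) := hGo.sdiff isClosed_closedBall
  have hfr : ∀ z ∈ frontier (G \ closedBall (φ q) ρ), H z ∉ ball (φ q) r := by
    intro z hz hzr
    have hzG : z ∈ closure G := closure_mono sdiff_subset hz.1
    have hzb : z ∉ ball (φ q) ρ := by
      intro hzb
      obtain ⟨y, hy, hy'⟩ := mem_closure_iff.1 hz.1 _ isOpen_ball hzb
      exact hy'.2 (ball_subset_closedBall hy)
    have hzn : z ∉ G \ closedBall (φ q) ρ := fun h => hz.2 (by rwa [hG₂.interior_eq])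
    by_cases hzG' : z ∈ G
    · have h1 : z ∈ closedBall (φ q) ρ := by
        by_contra h1
        exact hzn ⟨hzG', h1⟩
      rw [Hb z h1] at hzr
      exact hzb (ball_subset_ball (min_le_right _ _) hzr)
    · exact Hfar z (hGX ⟨hzG, by rwa [hGo.interior_eq]⟩) hzb hzr
  obtain ⟨d, hd⟩ := HasDeg.exists hH (hG.subset sdiff_subset) hG₂ (y := φ q) (by
    rintro ⟨z, hz, e⟩
    exact hfr z hz (by rw [e]; exact mem_ball_self hr0))
  have hd' : ∀ a ∈ ball (φ q) r, HasDeg H (G \ closedBall (φ q) ρ) a d := fun a ha =>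
    hd.of_isPreconnected hH (hG.subset sdiff_subset) hG₂ (convex_ball (φ q) r).isPreconnected
      (disjoint_left.2 (by
        rintro _ hy ⟨z, hz, rfl⟩
        exact hfr z hz hy)) (mem_ball_self hr0) ha
  refine ⟨u, d, fun a ⟨har, haX⟩ => ?_⟩
  have haρ : a ∈ ball (φ q) ρ := ball_subset_ball (min_le_right _ _) har
  have hGF : ∀ z ∈ frontier G, H z = φ (ψ z) := by
    intro z hz
    obtain ⟨x, hx, rfl⟩ := hGX hz
    lift x to sphere (0 : E) 1 using hx
    rw [Hs, hψc]
  have e₁ : HasDeg (fun x => φ (ψ x)) G a (u * w a) := by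
    refine HasDeg.comp hψ hφ hG hGo isBounded_ball isOpen_ball ?_ ?_ (fun z hz _ => hu' z hz) ?_
      (hw a haX)
    · rintro ⟨z, hz, rfl⟩
      exact haX (mem_image_of_mem φ (hψG z hz))
    · rwa [hfs]
    · intro z hz hza
      obtain ⟨x, hx⟩ := hout z hz
      exact absurd ⟨x, x.2, hx.symm.trans hza⟩ haX
  have e₂ : HasDeg H G a (u * w a) := e₁.congr fun z hz => (hGF z hz).symm
  have hG₁ : IsOpen (G ∩ ball (φ q) ρ) := hGo.inter isOpen_ball
  have hcl : closure (G ∩ ball (φ q) ρ) ⊆ closedBall (φ q) ρ :=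
    closure_minimal (inter_subset_right.trans ball_subset_closedBall) isClosed_closedBall
  have e₃ : HasDeg (fun x => x) (G ∩ ball (φ q) ρ) a (G.indicator 1 a) := by
    by_cases haG : a ∈ G
    · rw [indicator_of_mem haG]
      exact HasDeg.id_of_mem (hG.subset inter_subset_left) hG₁ ⟨haG, haρ⟩
    · rw [indicator_of_notMem haG]
      refine HasDeg.zero_of_notMem continuous_id (hG.subset inter_subset_left) hG₁ ?_
      rintro ⟨z, hz, rfl⟩
      exact haX (hGX ⟨closure_mono inter_subset_left hz, by rwa [hGo.interior_eq]⟩)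
  have e₄ : HasDeg H (G ∩ ball (φ q) ρ) a (G.indicator 1 a) :=
    e₃.congr fun z hz => (Hb z (hcl hz.1)).symm
  refine e₂.unique hH (HasDeg.add hH hG hGo hG₁ hG₂ inter_subset_left sdiff_subset ?_ ?_ e₄
    (hd' a har))
  · exact disjoint_left.2 fun z hz hz' => hz'.2 (ball_subset_closedBall hz.2)
  · rintro ⟨z, ⟨hzG, hz⟩, rfl⟩
    by_cases hzG' : z ∈ G
    · have hzb : z ∉ ball (φ q) ρ := fun h => hz (.inl ⟨hzG', h⟩)
      have hzc : z ∈ closedBall (φ q) ρ := by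
        by_contra h
        exact hz (.inr ⟨hzG', h⟩)
      rw [Hb z hzc] at haρ
      exact hzb haρ
    · exact haX (HX z (hGX ⟨hzG, by rwa [hGo.interior_eq]⟩))

/-- The degree function is not constant near an injectivity point. -/
theorem not_forall_degree_eq {φ : E → E} (hφ : Continuous φ)
    {U : Set (sphere (0 : E) 1)} {q : sphere (0 : E) 1} (hU : U ∈ 𝓝 q)
    (hinj : ∀ p ∈ U, ∀ x : sphere (0 : E) 1, φ x = φ p → x = p) {w : E → ℝ}
    (hw : ∀ y ∉ φ '' sphere 0 1, HasDeg φ (ball 0 1) y (w y)) {r : ℝ} (hr : 0 < r) (κ : ℝ) :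
    ¬ ∀ a ∈ ball (φ q) r \ φ '' sphere 0 1, w a = κ := by
  intro hκ
  have hφs : Continuous fun x : sphere (0 : E) 1 => φ x := by fun_prop
  obtain ⟨c, hc, hcn, -, hcU, -, hct⟩ := exists_sphere_collapse q
    (inter_mem hU (hφs.continuousAt.preimage_mem_nhds (ball_mem_nhds (φ q) hr)))
  have hfs : frontier (ball (0 : E) 1) = sphere 0 1 := frontier_ball 0 one_ne_zero
  have hq0 : -(q : E) ≠ 0 := neg_ne_zero.2 (ne_zero_of_mem_unit_sphere q)
  have hfib : ∀ x y : sphere (0 : E) 1, φ x = φ y → c x = c y := by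
    intro x y hxy
    by_cases hx : x ∈ U
    · rw [hinj x hx y hxy.symm]
    by_cases hy : y ∈ U
    · rw [hinj y hy x hxy]
    rw [hcU x fun h => hx h.1, hcU y fun h => hy h.1]
  have hcl : IsClosed (ball (φ q) r)ᶜ := isOpen_ball.isClosed_compl
  obtain ⟨ψ, hψ, HZ⟩ := exists_continuous_factor
    (Z := sphere (0 : E) 1 ⊕ ((ball (φ q) r)ᶜ : Set E))
    (p := Sum.elim (fun x => φ x) Subtype.val) (c := Sum.elim c fun _ => -(q : E))
    (hφs.sumElim continuous_subtype_val) (hφs.isClosedMap.sumElim hcl.isClosedMap_subtype_val)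
    (hc.sumElim continuous_const) (by
      have key : ∀ (x : sphere (0 : E) 1) (z : ((ball (φ q) r)ᶜ : Set E)), φ x = z →
          c x = -q := fun x z hxz => hcU x fun h => z.2 (hxz ▸ h.2)
      rintro (x | z) (y | z') h
      · exact hfib x y h
      · exact key x z' h
      · exact (key y z h.symm).symm
      · rfl)
  have hψs : ∀ x : sphere (0 : E) 1, ψ (φ x) = c x := fun x => HZ (.inl x)
  have hψb : ∀ z ∉ ball (φ q) r, ψ z = -q := fun z hz => HZ (.inr ⟨z, hz⟩)
  have hfb : ∀ z ∈ frontier (ball (φ q) r), z ∉ ball (φ q) r := fun z hz h =>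
    isOpen_ball.inter_frontier_eq.subset ⟨h, hz⟩
  have hc0 : ∀ x, c x ≠ 0 := fun x h => by simpa [h] using hcn x
  have e₀ : HasDeg ψ (ball (φ q) r) 0 0 := by
    have : HasDeg (fun _ : E => -(q : E)) (ball (φ q) r) 0 0 :=
      HasDeg.zero_of_notMem continuous_const isBounded_ball isOpen_ball (by
        rintro ⟨z, -, e⟩
        exact hq0 e)
    exact this.congr fun z hz => (hψb z (hfb z hz)).symm
  have e₁ : HasDeg (fun x => ψ (φ x)) (ball 0 1) 0 (κ * 0) := by
    refine HasDeg.comp hφ hψ isBounded_ball isOpen_ball isBounded_ball isOpen_ball ?_ ?_ ?_ ?_ e₀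
    · rintro ⟨x, hx, e⟩
      rw [hfs] at hx
      exact hc0 ⟨x, hx⟩ ((hψs ⟨x, hx⟩).symm.trans e)
    · rintro ⟨z, hz, e⟩
      exact hq0 ((hψb z (hfb z hz)).symm.trans e)
    · intro z hz hz0
      have hzX : z ∉ φ '' sphere 0 1 := by
        rintro ⟨x, hx, rfl⟩
        exact hc0 ⟨x, hx⟩ ((hψs ⟨x, hx⟩).symm.trans hz0)
      rw [← hκ z ⟨hz, hzX⟩]
      exact hw z hzX
    · intro z hz hz0
      exact absurd ((hψb z hz).symm.trans hz0) hq0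
  have e₂ : HasDeg (fun x => ψ (φ x)) (ball 0 1) 0 1 := by
    refine (HasDeg.id_of_mem isBounded_ball isOpen_ball (mem_ball_self one_pos)).homotopy
      continuous_id (hψ.comp hφ) isBounded_ball isOpen_ball fun x hx t ht => ?_
    rw [hfs] at hx
    have := hct ⟨x, hx⟩ t ht
    rwa [← hψs] at this
  have := e₁.unique (hψ.comp hφ) e₂
  norm_num at this

/-- The degree function of a map on the unit ball. -/
theorem exists_degree_function {φ : E → E} (hφ : Continuous φ) :
    ∃ w : E → ℝ, ∀ y ∉ φ '' sphere 0 1, HasDeg φ (ball 0 1) y (w y) := by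
  have : ∀ y, ∃ d, y ∉ φ '' sphere 0 1 → HasDeg φ (ball 0 1) y d := by
    intro y
    by_cases hy : y ∈ φ '' sphere 0 1
    · exact ⟨0, fun h => absurd hy h⟩
    · obtain ⟨d, hd⟩ := HasDeg.exists hφ isBounded_ball isOpen_ball (Ω := ball 0 1) (y := y)
        (by rwa [frontier_ball _ one_ne_zero])
      exact ⟨d, fun _ => hd⟩
  choose w hw using this
  exact ⟨w, hw⟩

theorem degree_function_eq {φ : E → E} (hφ : Continuous φ) {w : E → ℝ}
    (hw : ∀ y ∉ φ '' sphere 0 1, HasDeg φ (ball 0 1) y (w y)) {a b : E}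
    (ha : a ∉ φ '' sphere 0 1) (hb : b ∈ connectedComponentIn (φ '' sphere 0 1)ᶜ a) :
    w b = w a := by
  have hsub := connectedComponentIn_subset (φ '' sphere 0 1)ᶜ a
  refine HasDeg.unique hφ (hw b (hsub hb)) ((hw a ha).of_isPreconnected hφ isBounded_ball
    isOpen_ball isPreconnected_connectedComponentIn ?_ (mem_connectedComponentIn ha) hb)
  rw [frontier_ball _ one_ne_zero]
  exact disjoint_left.2 fun z hz => hsub hz

end Separation

section Components

variable {E : Type*} [NormedAddCommGroup E] [InnerProductSpace ℝ E] [FiniteDimensional ℝ E]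
  [MeasurableSpace E] [BorelSpace E]

/-- Near an injectivity point, the degree function separates bounded complementary components
from the other ones, and at most two complementary components are present. -/
theorem exists_ball_components (hE : 1 < Module.rank ℝ E) {φ : E → E} (hφ : Continuous φ)
    (hout : ∀ z ∉ ball (0 : E) 1, ∃ x : sphere (0 : E) 1, φ z = φ x)
    {U : Set (sphere (0 : E) 1)} {q : sphere (0 : E) 1} (hU : U ∈ 𝓝 q)
    (hinj : ∀ p ∈ U, ∀ x : sphere (0 : E) 1, φ x = φ p → x = p) {w : E → ℝ}
    (hw : ∀ y ∉ φ '' sphere 0 1, HasDeg φ (ball 0 1) y (w y)) {X : Set E}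
    (hX : X = φ '' sphere 0 1) :
    ∃ r > 0, (∀ a ∈ ball (φ q) r \ X, ∀ b ∈ ball (φ q) r \ X,
        connectedComponentIn Xᶜ a ≠ connectedComponentIn Xᶜ b →
        IsBounded (connectedComponentIn Xᶜ a) → w a ≠ w b) ∧
      ∀ a ∈ ball (φ q) r \ X, ∀ b ∈ ball (φ q) r \ X, ∀ e ∈ ball (φ q) r \ X,
        connectedComponentIn Xᶜ a ≠ connectedComponentIn Xᶜ b →
        connectedComponentIn Xᶜ e = connectedComponentIn Xᶜ a ∨
          connectedComponentIn Xᶜ e = connectedComponentIn Xᶜ b := by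
  obtain ⟨r, hr, H⟩ := exists_degree_relation hφ hout hU hinj hw
  rw [← hX] at H
  have hXc : IsCompact X := hX ▸ (isCompact_sphere 0 1).image hφ
  have rel : ∀ a ∈ ball (φ q) r \ X, IsBounded (connectedComponentIn Xᶜ a) → ∃ u : ℝ, u ≠ 0 ∧
      (∀ b ∈ ball (φ q) r \ X, connectedComponentIn Xᶜ a ≠ connectedComponentIn Xᶜ b →
        u * (w a - w b) = 1) ∧
      ∀ b ∈ ball (φ q) r \ X, ∀ e ∈ ball (φ q) r \ X,
        connectedComponentIn Xᶜ a ≠ connectedComponentIn Xᶜ b →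
        connectedComponentIn Xᶜ a ≠ connectedComponentIn Xᶜ e → w b = w e := by
    intro a ha hab
    obtain ⟨u, d, hud⟩ := H _ hab hXc.isClosed.isOpen_compl.connectedComponentIn
      (frontier_connectedComponentIn_subset hXc.isClosed a)
    have h1 : u * w a = 1 + d := by
      rw [hud a ha, indicator_of_mem (mem_connectedComponentIn ha.2), Pi.one_apply]
    have h0 : ∀ b ∈ ball (φ q) r \ X, connectedComponentIn Xᶜ a ≠ connectedComponentIn Xᶜ b →
        u * w b = d := by
      intro b hb hne
      rw [hud b hb, indicator_of_notMem fun h => hne (connectedComponentIn_eq h), zero_add]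
    by_cases hu : u = 0
    · refine ⟨1, one_ne_zero, fun b hb hne => ?_, fun b hb e he hne _ => ?_⟩ <;>
      · have h2 := h0 b hb hne
        rw [hu] at h1 h2
        linarith
    refine ⟨u, hu, fun b hb hne => ?_, fun b hb e he hbne hene => ?_⟩
    · rw [mul_sub, h1, h0 b hb hne]; ring
    · exact mul_left_cancel₀ hu ((h0 b hb hbne).trans (h0 e he hene).symm)
  have sep : ∀ a ∈ ball (φ q) r \ X, ∀ b ∈ ball (φ q) r \ X,
        connectedComponentIn Xᶜ a ≠ connectedComponentIn Xᶜ b →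
        IsBounded (connectedComponentIn Xᶜ a) → w a ≠ w b := by
    intro a ha b hb hne hab heq
    obtain ⟨u, -, h, -⟩ := rel a ha hab
    have := h b hb hne
    rw [heq, sub_self, mul_zero] at this
    exact zero_ne_one this
  have two : ∀ a ∈ ball (φ q) r \ X, ∀ b ∈ ball (φ q) r \ X, ∀ e ∈ ball (φ q) r \ X,
        connectedComponentIn Xᶜ a ≠ connectedComponentIn Xᶜ b →
        connectedComponentIn Xᶜ a ≠ connectedComponentIn Xᶜ e →
        connectedComponentIn Xᶜ b ≠ connectedComponentIn Xᶜ e →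
        IsBounded (connectedComponentIn Xᶜ a) → ¬ IsBounded (connectedComponentIn Xᶜ b) := by
    intro a ha b hb e he hab hae hbe hba hbb
    obtain ⟨u, -, -, h⟩ := rel a ha hba
    exact sep b hb e he hbe hbb (h b hb e he hab hae)
  refine ⟨r, hr, sep, fun a ha b hb e he hab => ?_⟩
  by_contra! hcon
  have unb := fun x y => connectedComponentIn_eq_of_not_isBounded hE hXc.isBounded (a := x) (b := y)
  by_cases hba : IsBounded (connectedComponentIn Xᶜ a)
  · have h1 := two a ha b hb e he hab hcon.1.symm hcon.2.symm hba
    have h2 := two a ha e he b hb hcon.1.symm hab hcon.2 hba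
    exact hcon.2 (unb e b h2 h1)
  · have hbb : IsBounded (connectedComponentIn Xᶜ b) := by
      by_contra h
      exact hab (unb a b hba h)
    have h2 := two b hb e he a ha hcon.2.symm hab.symm hcon.1 hbb
    exact hcon.1 (unb e a h2 hba)

/-- Exactly two complementary components are adjacent to an injectivity point. -/
theorem exists_two_components (hE : 1 < Module.rank ℝ E) {φ : E → E} (hφ : Continuous φ)
    (hout : ∀ z ∉ ball (0 : E) 1, ∃ x : sphere (0 : E) 1, φ z = φ x)
    {U : Set (sphere (0 : E) 1)} {q : sphere (0 : E) 1} (hU : U ∈ 𝓝 q)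
    (hinj : ∀ p ∈ U, ∀ x : sphere (0 : E) 1, φ x = φ p → x = p) {X : Set E}
    (hX : X = φ '' sphere 0 1) :
    ∃ C₁ C₂ : Set E, C₁ ≠ C₂ ∧ IsConnCompIn Xᶜ C₁ ∧ IsConnCompIn Xᶜ C₂ ∧
      φ q ∈ closure C₁ ∧ φ q ∈ closure C₂ ∧
      ∀ C, IsConnCompIn Xᶜ C → φ q ∈ closure C → C = C₁ ∨ C = C₂ := by
  obtain ⟨w, hw⟩ := exists_degree_function hφ
  obtain ⟨r, hr, -, H⟩ := exists_ball_components hE hφ hout hU hinj hw hX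
  have key : ∀ ε > 0, ∃ a ∈ ball (φ q) ε \ X, ∃ b ∈ ball (φ q) ε \ X,
      connectedComponentIn Xᶜ a ≠ connectedComponentIn Xᶜ b := by
    intro ε hε
    have hne := not_forall_degree_eq hφ hU hinj hw hε
    rw [← hX] at hne
    have h1 := hne 0
    push Not at h1
    obtain ⟨a, ha, -⟩ := h1
    have h2 := hne (w a)
    push Not at h2
    obtain ⟨b, hb, hba⟩ := h2
    refine ⟨a, ha, b, hb, fun e => hba ?_⟩
    subst hX
    refine degree_function_eq hφ hw ha.2 ?_
    rw [e]
    exact mem_connectedComponentIn hb.2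
  obtain ⟨a, ha, b, hb, hab⟩ := key r hr
  have hcl : φ q ∈ closure (connectedComponentIn Xᶜ a) ∧
      φ q ∈ closure (connectedComponentIn Xᶜ b) := by
    simp only [Metric.mem_closure_iff, ← forall₂_and]
    intro ε hε
    obtain ⟨a', ha', b', hb', hab'⟩ := key (min ε r) (lt_min hε hr)
    have hr' : ball (φ q) (min ε r) ⊆ ball (φ q) r := ball_subset_ball (min_le_right _ _)
    have hε' : ∀ z ∈ ball (φ q) (min ε r), dist (φ q) z < ε := fun z hz => by
      rw [dist_comm]
      exact ball_subset_ball (min_le_left _ _) hz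
    have ma := mem_connectedComponentIn (F := Xᶜ) ha'.2
    have mb := mem_connectedComponentIn (F := Xᶜ) hb'.2
    rcases H a ha b hb a' ⟨hr' ha'.1, ha'.2⟩ hab with h1 | h1 <;>
    rcases H a ha b hb b' ⟨hr' hb'.1, hb'.2⟩ hab with h2 | h2
    · exact absurd (h1.trans h2.symm) hab'
    · exact ⟨⟨a', h1 ▸ ma, hε' a' ha'.1⟩, ⟨b', h2 ▸ mb, hε' b' hb'.1⟩⟩
    · exact ⟨⟨b', h2 ▸ mb, hε' b' hb'.1⟩, ⟨a', h1 ▸ ma, hε' a' ha'.1⟩⟩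
    · exact absurd (h1.trans h2.symm) hab'
  refine ⟨_, _, hab, ⟨a, ha.2, rfl⟩, ⟨b, hb.2, rfl⟩, hcl.1, hcl.2, ?_⟩
  rintro C ⟨x, hx, rfl⟩ hC
  obtain ⟨e, he, her⟩ := Metric.mem_closure_iff.1 hC r hr
  rw [connectedComponentIn_eq he]
  refine H a ha b hb e ⟨?_, connectedComponentIn_subset _ _ he⟩ hab
  rwa [mem_ball, dist_comm]

/-- Maps on the ball hit the component adjacent to an injectivity point on the inner side. -/
theorem subset_image_of_isConnCompIn (hE : 1 < Module.rank ℝ E) {φ : E → E} (hφ : Continuous φ)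
    (hout : ∀ z ∉ ball (0 : E) 1, ∃ x : sphere (0 : E) 1, φ z = φ x)
    {U : Set (sphere (0 : E) 1)} {q : sphere (0 : E) 1} (hU : U ∈ 𝓝 q)
    (hinj : ∀ p ∈ U, ∀ x : sphere (0 : E) 1, φ x = φ p → x = p) {X : Set E}
    (hX : X = φ '' sphere 0 1) {U₁ U₂ : Set E} (h₁ : IsConnCompIn Xᶜ U₁)
    (h₂ : IsConnCompIn Xᶜ U₂) (hne : U₁ ≠ U₂) (hq₁ : φ q ∈ closure U₁) (hq₂ : φ q ∈ closure U₂)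
    (hb : ¬ IsBounded U₁) : U₂ ⊆ φ '' closedBall 0 1 := by
  obtain ⟨w, hw⟩ := exists_degree_function hφ
  obtain ⟨r, hr, H, -⟩ := exists_ball_components hE hφ hout hU hinj hw hX
  have hXc : IsCompact X := hX ▸ (isCompact_sphere 0 1).image hφ
  have rep : ∀ V, IsConnCompIn Xᶜ V → φ q ∈ closure V →
      ∃ a ∈ ball (φ q) r \ X, V = connectedComponentIn Xᶜ a := by
    rintro V ⟨x, hx, rfl⟩ hV
    obtain ⟨e, he, her⟩ := Metric.mem_closure_iff.1 hV r hr
    refine ⟨e, ⟨?_, connectedComponentIn_subset _ _ he⟩, connectedComponentIn_eq he⟩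
    rwa [mem_ball, dist_comm]
  obtain ⟨a, ha, rfl⟩ := rep _ h₁ hq₁
  obtain ⟨b, hb', rfl⟩ := rep _ h₂ hq₂
  have hbb : IsBounded (connectedComponentIn Xᶜ b) := by
    by_contra h
    exact hne (connectedComponentIn_eq_of_not_isBounded hE hXc.isBounded hb h)
  have hwne := H b hb' a ha hne.symm hbb
  have zero : ∀ y ∉ X, y ∉ φ '' closedBall 0 1 → w y = 0 := fun y hyX hy =>
    (hw y (hX ▸ hyX)).unique hφ (HasDeg.zero_of_notMem hφ isBounded_ball isOpen_ball
      (by rwa [closure_ball _ one_ne_zero]))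
  have hconst : ∀ a ∉ X, ∀ y ∈ connectedComponentIn Xᶜ a, w y = w a := by
    subst hX
    exact fun a ha y hy => degree_function_eq hφ hw ha hy
  have hwa : w a = 0 := by
    obtain ⟨y, hy, hyn⟩ : ∃ y ∈ connectedComponentIn Xᶜ a, y ∉ φ '' closedBall 0 1 := by
      by_contra! hcon
      exact hb (((isCompact_closedBall (0 : E) 1).image hφ).isBounded.subset hcon)
    rw [← hconst a ha.2 y hy]
    exact zero y (connectedComponentIn_subset _ _ hy) hyn
  intro y hy
  by_contra hyn
  have h1 := hconst b hb'.2 y hy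
  rw [zero y (connectedComponentIn_subset _ _ hy) hyn] at h1
  exact hwne (h1.symm.trans hwa.symm)

end Components

end MapDegree

/-- Let `n ≥ 2` and let `f : Sⁿ → ℝⁿ⁺¹` be a continuous map whose set of
injectivity contains a nonempty open set `U`, and let `q ∈ U`.  Then there are precisely
two connected components `U₁, U₂` of `ℝⁿ⁺¹ \ f(Sⁿ)` containing `f(q)` in their closure;
and whenever `U₁` is unbounded, every continuous extension `F : Dⁿ⁺¹ → ℝⁿ⁺¹` of `f` to the
closed unit ball surjects onto `U₂`. -/
theorem strong_jordan_separation_euclidean_unbounded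
    (n : ℕ) (hn : 2 ≤ n)
    (f : (Metric.sphere (0 : EuclideanSpace ℝ (Fin (n + 1))) 1) →
         EuclideanSpace ℝ (Fin (n + 1)))
    (hf : Continuous f)
    (U : Set (Metric.sphere (0 : EuclideanSpace ℝ (Fin (n + 1))) 1))
    (hUopen : IsOpen U) (hUne : U.Nonempty)
    (hUinj : ∀ p ∈ U, ∀ q, f q = f p → q = p)
    (q : Metric.sphere (0 : EuclideanSpace ℝ (Fin (n + 1))) 1) (hq : q ∈ U) :
    (∃ C₁ C₂ : Set (EuclideanSpace ℝ (Fin (n + 1))),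
      C₁ ≠ C₂ ∧
      IsConnCompIn (Set.range f)ᶜ C₁ ∧ IsConnCompIn (Set.range f)ᶜ C₂ ∧
      f q ∈ closure C₁ ∧ f q ∈ closure C₂ ∧
      (∀ C, IsConnCompIn (Set.range f)ᶜ C → f q ∈ closure C → C = C₁ ∨ C = C₂)) ∧
    ∀ U₁ U₂ : Set (EuclideanSpace ℝ (Fin (n + 1))),
      IsConnCompIn (Set.range f)ᶜ U₁ → IsConnCompIn (Set.range f)ᶜ U₂ → U₁ ≠ U₂ →
      f q ∈ closure U₁ → f q ∈ closure U₂ →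
      ¬ Bornology.IsBounded U₁ →
      ∀ F : (Metric.closedBall (0 : EuclideanSpace ℝ (Fin (n + 1))) 1) →
            EuclideanSpace ℝ (Fin (n + 1)),
        Continuous F →
        (∀ x : (Metric.sphere (0 : EuclideanSpace ℝ (Fin (n + 1))) 1),
          F ⟨x.1, Metric.sphere_subset_closedBall x.2⟩ = f x) →
        U₂ ⊆ Set.range F := by
  have hE : 1 < Module.rank ℝ (EuclideanSpace ℝ (Fin (n + 1))) := by
    rw [← Module.finrank_eq_rank, finrank_euclideanSpace_fin]
    exact_mod_cast (by omega : 1 < n + 1)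
  have hUq : U ∈ nhds q := hUopen.mem_nhds hq
  have extend : ∀ F : (Metric.closedBall (0 : EuclideanSpace ℝ (Fin (n + 1))) 1) →
      EuclideanSpace ℝ (Fin (n + 1)), Continuous F →
      (∀ x : (Metric.sphere (0 : EuclideanSpace ℝ (Fin (n + 1))) 1),
        F ⟨x.1, Metric.sphere_subset_closedBall x.2⟩ = f x) →
      ∃ φ : EuclideanSpace ℝ (Fin (n + 1)) → EuclideanSpace ℝ (Fin (n + 1)), Continuous φ ∧
        (∀ x : Metric.sphere (0 : EuclideanSpace ℝ (Fin (n + 1))) 1, φ x = f x) ∧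
        (∀ z, φ z ∈ Set.range F) ∧
        (∀ z ∉ Metric.ball (0 : EuclideanSpace ℝ (Fin (n + 1))) 1,
          ∃ x : Metric.sphere (0 : EuclideanSpace ℝ (Fin (n + 1))) 1, φ z = φ x) ∧
        Set.range f = φ '' Metric.sphere 0 1 := by
    intro F hF hFf
    obtain ⟨φ, hφ, hφF, hφr, hout⟩ := MapDegree.exists_radial_extension hF
    have hφf : ∀ x : Metric.sphere (0 : EuclideanSpace ℝ (Fin (n + 1))) 1, φ x = f x :=
      fun x => (hφF ⟨x.1, Metric.sphere_subset_closedBall x.2⟩).trans (hFf x)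
    refine ⟨φ, hφ, hφf, hφr, hout, ?_⟩
    rw [Set.image_eq_range]
    exact congrArg Set.range (funext fun x => (hφf x).symm)
  refine ⟨?_, fun U₁ U₂ h₁ h₂ hne hq₁ hq₂ hb F hF hFf => ?_⟩
  · obtain ⟨g, hg⟩ := ContinuousMap.exists_restrict_eq Metric.isClosed_sphere ⟨f, hf⟩
    obtain ⟨φ, hφ, hφf, -, hout, hX⟩ := extend (fun x => g x)
      (g.continuous.comp continuous_subtype_val) (fun x => DFunLike.congr_fun hg x)
    rw [← hφf q]
    exact MapDegree.exists_two_components hE hφ hout hUq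
      (fun p hp x hx => hUinj p hp x (by rw [← hφf, ← hφf, hx])) hX
  · obtain ⟨φ, hφ, hφf, hφr, hout, hX⟩ := extend F hF hFf
    rw [← hφf q] at hq₁ hq₂
    refine (MapDegree.subset_image_of_isConnCompIn hE hφ hout hUq
      (fun p hp x hx => hUinj p hp x (by rw [← hφf, ← hφf, hx])) hX h₁ h₂ hne hq₁ hq₂ hb).trans ?_
    rintro _ ⟨z, -, rfl⟩
    exact hφr z
end

section
/- Let m ≥ 1 and let S^m be the unit sphere in ℝ^{m+1}. Let (U_i)_{i ∈ ℕ} be a countable family of pairwise disjoint nonempty open metric balls in S^m whose union ⋃_i U_i is dense in S^m, and let p ∈ S^m be a point which does not lie in the closure of any U_i. Then for every neighborhood N of p in S^m there exists an index i with U_i ⊆ N. -/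
open Metric Set in
/-- In a compact space, only finitely many members of a family of pairwise disjoint balls have
radius bounded below by a given positive number. -/
theorem finite_setOf_le_radius_of_pairwise_disjoint_ball {X ι : Type*} [PseudoMetricSpace X]
    [CompactSpace X] {c : ι → X} {ρ : ι → ℝ}
    (hdisj : Pairwise (Function.onFun Disjoint (fun i => ball (c i) (ρ i))))
    {ε : ℝ} (hε : 0 < ε) : {i | ε ≤ ρ i}.Finite := by
  obtain ⟨t, -, ht, hcov⟩ := finite_cover_balls_of_compact (isCompact_univ (X := X)) (half_pos hε)
  have hex : ∀ i, ∃ x ∈ t, dist (c i) x < ε / 2 := fun i => by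
    simpa using hcov (mem_univ (c i))
  choose f hft hf using hex
  refine Set.Finite.of_finite_image (f := f) (ht.subset ?_) ?_
  · rintro _ ⟨i, -, rfl⟩
    exact hft i
  · intro i hi j hj hij
    by_contra hne
    simp only [mem_ofPred_eq] at hi hj
    have hdist : dist (c i) (c j) < ε := by
      have := dist_triangle_right (c i) (c j) (f i)
      have h₁ := hf i
      have h₂ := hf j
      rw [← hij] at h₂
      linarith
    exact disjoint_left.1 (hdisj hne) (mem_ball_self (by linarith)) (mem_ball.2 (by linarith))

open Metric Set in
/-- In a compact space, if a family of pairwise disjoint balls has dense union, then every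
neighborhood of a point outside the closures of all the balls contains one of the balls. -/
theorem exists_ball_subset_of_dense_iUnion_ball {X ι : Type*} [PseudoMetricSpace X]
    [CompactSpace X] {c : ι → X} {ρ : ι → ℝ}
    (hdisj : Pairwise (Function.onFun Disjoint (fun i => ball (c i) (ρ i))))
    (hdense : Dense (⋃ i, ball (c i) (ρ i)))
    {p : X} (hp : ∀ i, p ∉ closure (ball (c i) (ρ i))) {N : Set X} (hN : N ∈ nhds p) :
    ∃ i, ball (c i) (ρ i) ⊆ N := by
  by_contra! hcon
  obtain ⟨r, hr, hrN⟩ := Metric.mem_nhds_iff.1 hN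
  have hfin : {i | r / 4 ≤ ρ i}.Finite :=
    finite_setOf_le_radius_of_pairwise_disjoint_ball hdisj (by positivity)
  have hclosed : IsClosed (⋃ i ∈ {i | r / 4 ≤ ρ i}, closure (ball (c i) (ρ i))) :=
    hfin.isClosed_biUnion fun _ _ => isClosed_closure
  have hnhds : (⋃ i ∈ {i | r / 4 ≤ ρ i}, closure (ball (c i) (ρ i)))ᶜ ∩ ball p (r / 2) ∈ nhds p :=
    Filter.inter_mem (hclosed.isOpen_compl.mem_nhds (by simpa using fun i _ => hp i))
      (ball_mem_nhds p (by positivity))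
  obtain ⟨x, ⟨hx, hxp⟩, hxU⟩ := mem_closure_iff_nhds.1 (hdense p) _ hnhds
  obtain ⟨i, hi⟩ := mem_iUnion.1 hxU
  refine hx (mem_biUnion (x := i) ?_ (subset_closure hi))
  obtain ⟨y, hy, hyN⟩ := not_subset.1 (hcon i)
  have hyp : r ≤ dist y p := not_lt.1 fun h => hyN (hrN h)
  rw [mem_ball] at hi hy hxp
  have h₁ := dist_triangle y x p
  have h₂ := dist_triangle_right y x (c i)
  simp only [mem_ofPred_eq]
  linarith

/-- Let `m ≥ 1` and let `(B(c i, ρ i))` be a countable family of pairwise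
disjoint nonempty open metric balls in `Sᵐ` whose union is dense in `Sᵐ`, and let `p ∈ Sᵐ`
not lie in the closure of any of them.  Then every neighborhood of `p` contains one of the
balls. -/
theorem exists_ball_in_neighborhood_of_dense_disjoint_balls
    (m : ℕ) (hm : 1 ≤ m)
    (c : ℕ → Metric.sphere (0 : EuclideanSpace ℝ (Fin (m + 1))) 1)
    (ρ : ℕ → ℝ) (hρ : ∀ i, 0 < ρ i)
    (hdisj : Pairwise (Function.onFun Disjoint (fun i => Metric.ball (c i) (ρ i))))
    (hdense : Dense (⋃ i, Metric.ball (c i) (ρ i)))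
    (p : Metric.sphere (0 : EuclideanSpace ℝ (Fin (m + 1))) 1)
    (hp : ∀ i, p ∉ closure (Metric.ball (c i) (ρ i))) :
    ∀ N ∈ nhds p, ∃ i, Metric.ball (c i) (ρ i) ⊆ N := by
  exact fun N hN => exists_ball_subset_of_dense_iUnion_ball hdisj hdense hp hN
end

section
/- Let m ≥ 2 and let A ⊆ ℝ^m be a closed subset such that A is homeomorphic to a closed subset of the sphere S^{m-1} and such that A separates ℝ^m (i.e. ℝ^m \ A is disconnected). Then A is homeomorphic to S^{m-1}. -/
open Set Metric MeasureTheory Module Polynomial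

/-- The determinant of `1 + t • M` is a polynomial in `t` of degree at most the dimension. -/
theorem ContinuousLinearMap.exists_polynomial_eval_eq_det_one_add_smul
    {E : Type*} [NormedAddCommGroup E] [NormedSpace ℝ E] [FiniteDimensional ℝ E] (M : E →L[ℝ] E) :
    ∃ p : ℝ[X], p.natDegree ≤ finrank ℝ E ∧ ∀ t : ℝ, p.eval t = (1 + t • M).det := by
  classical
  let b := finBasis ℝ E
  let A := LinearMap.toMatrix b b (M : E →ₗ[ℝ] E)
  refine ⟨((X : ℝ[X]) • A.map C + (1 : Matrix _ _ ℝ).map C).det, ?_, fun t => ?_⟩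
  · simpa using natDegree_det_X_add_C_le A 1
  · rw [← coe_evalRingHom, RingHom.map_det]
    have h : (1 + t • M).det = LinearMap.det ((1 + t • M : E →L[ℝ] E) : E →ₗ[ℝ] E) := rfl
    rw [h, ← LinearMap.det_toMatrix b]
    congr 1
    have h2 : ((1 + t • M : E →L[ℝ] E) : E →ₗ[ℝ] E) = LinearMap.id + t • (M : E →ₗ[ℝ] E) := rfl
    rw [h2, map_add (LinearMap.toMatrix b b), map_smul (LinearMap.toMatrix b b),
      LinearMap.toMatrix_id]
    ext i j
    rcases eq_or_ne i j with rfl | hij <;> simp [A, add_comm, mul_comm t, *]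

theorem ContinuousLinearMap.det_one_add_smul_nonneg
    {E : Type*} [NormedAddCommGroup E] [NormedSpace ℝ E] [FiniteDimensional ℝ E] (M : E →L[ℝ] E)
    {t : ℝ} (ht : 0 ≤ t) (htM : t * ‖M‖ < 1) : 0 ≤ (1 + t • M).det := by
  obtain ⟨p, -, hp⟩ := M.exists_polynomial_eval_eq_det_one_add_smul
  by_contra! hneg
  rw [← hp] at hneg
  have h0 : p.eval 0 = 1 := by rw [hp]; simp [ContinuousLinearMap.det]
  obtain ⟨s, hs, hs0⟩ := intermediate_value_Icc' ht p.continuous.continuousOn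
    (show (0 : ℝ) ∈ Icc (p.eval t) (p.eval 0) from ⟨hneg.le, by simp [h0]⟩)
  have hlt : ‖-(s • M)‖ < 1 := by
    rw [norm_neg, norm_smul, Real.norm_of_nonneg hs.1]
    exact (mul_le_mul_of_nonneg_right hs.2 (norm_nonneg _)).trans_lt htM
  have hu := isUnit_one_sub_of_norm_lt_one hlt
  rw [sub_neg_eq_add] at hu
  have hd := LinearMap.isUnit_det _ (hu.map (ContinuousLinearMap.toLinearMapRingHom : (E →L[ℝ] E) →+* (E →ₗ[ℝ] E)))
  exact hd.ne_zero ((hp s).symm.trans hs0)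

/-- A Lipschitz function on a closed ball vanishing on the boundary sphere stays Lipschitz after
extension by zero. -/
theorem LipschitzOnWith.lipschitzWith_indicator_closedBall
    {E F : Type*} [NormedAddCommGroup E] [NormedSpace ℝ E] [NormedAddCommGroup F]
    {u : E → F} {K : NNReal} {R : ℝ} (hu : LipschitzOnWith K u (closedBall 0 R))
    (h0 : ∀ x ∈ sphere (0 : E) R, u x = 0) :
    LipschitzWith K ((closedBall 0 R).indicator u) := by
  have key : ∀ x ∈ closedBall (0 : E) R, ∀ y ∉ closedBall (0 : E) R, ‖u x‖ ≤ K * dist x y := by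
    intro x hx y hy
    have hc : ContinuousOn (fun t : ℝ => ‖AffineMap.lineMap x y t‖) (Icc 0 1) := by
      have : Continuous (AffineMap.lineMap x y : ℝ → E) := AffineMap.lineMap_continuous
      fun_prop
    simp only [mem_closedBall_zero_iff, not_le] at hx hy
    obtain ⟨t, ht, htR⟩ := intermediate_value_Icc zero_le_one hc
      (show R ∈ Icc _ _ by simpa using ⟨hx, hy.le⟩)
    set z := AffineMap.lineMap x y t
    have hz : u z = 0 := h0 z (by simpa using htR)
    have h1 := hu.dist_le_mul x (by simpa using hx) z (by simpa using htR.le)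
    rw [hz, dist_zero_right] at h1
    refine h1.trans (mul_le_mul_of_nonneg_left ?_ K.2)
    rw [dist_left_lineMap, Real.norm_of_nonneg ht.1]
    exact mul_le_of_le_one_left dist_nonneg ht.2
  refine LipschitzWith.of_dist_le_mul fun x y => ?_
  by_cases hx : x ∈ closedBall (0 : E) R <;> by_cases hy : y ∈ closedBall (0 : E) R
  · simpa [hx, hy] using hu.dist_le_mul x hx y hy
  · rw [indicator_of_mem hx, indicator_of_notMem hy, dist_zero_right]
    exact key x hx y hy
  · rw [indicator_of_mem hy, indicator_of_notMem hx, dist_zero_left, dist_comm]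
    exact key y hy x hx
  · rw [indicator_of_notMem hy, indicator_of_notMem hx, dist_self]
    positivity

theorem LipschitzWith.bijective_id_add_smul
    {E : Type*} [NormedAddCommGroup E] [NormedSpace ℝ E] [CompleteSpace E]
    {u : E → E} {K : NNReal} (hu : LipschitzWith K u) {t : ℝ} (ht : ‖t‖₊ * K < 1) :
    Function.Bijective fun x => x + t • u x := by
  rcases subsingleton_or_nontrivial E with hE | hE
  · exact ⟨Function.injective_of_subsingleton _, Function.surjective_to_subsingleton _⟩
  have hA : ApproximatesLinearOn (fun x => x + t • u x)
      ((ContinuousLinearEquiv.refl ℝ E : E ≃L[ℝ] E) : E →L[ℝ] E) univ (‖t‖₊ * K) := by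
    rw [ApproximatesLinearOn.approximatesLinearOn_iff_lipschitzOnWith, lipschitzOnWith_univ]
    have h : ((fun x => x + t • u x) - ((ContinuousLinearEquiv.refl ℝ E : E ≃L[ℝ] E) : E →L[ℝ] E))
        = fun x => t • u x := by
      ext x; simp
    rw [h]
    exact (lipschitzWith_smul t).comp hu
  have hN : ‖t‖₊ * K < ‖((ContinuousLinearEquiv.refl ℝ E).symm : E →L[ℝ] E)‖₊⁻¹ := by
    have : ((ContinuousLinearEquiv.refl ℝ E).symm : E →L[ℝ] E) = ContinuousLinearMap.id ℝ E := rfl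
    rw [this]
    simpa using ht
  exact ⟨(injOn_univ).1 (hA.injOn (Or.inr hN)), hA.surjective (Or.inr hN)⟩

section
variable {E : Type*} [NormedAddCommGroup E] [NormedSpace ℝ E] [FiniteDimensional ℝ E]
  [MeasurableSpace E] [BorelSpace E] (μ : Measure E) [μ.IsAddHaarMeasure]

theorem setIntegral_det_one_add_smul_of_lipschitzWith
    {u : E → E} {u' : E → E →L[ℝ] E} {K : NNReal} (hu : LipschitzWith K u) {R : ℝ}
    (h0 : ∀ x ∉ ball (0 : E) R, u x = 0) (hu' : ∀ x ∈ ball (0 : E) R, HasFDerivAt u (u' x) x)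
    {t : ℝ} (ht : 0 ≤ t) (htK : t * K < 1) :
    ∫ x in ball (0 : E) R, (1 + t • u' x).det ∂μ = μ.real (ball 0 R) := by
  set f : E → E := fun x => x + t • u x
  have hbij : Function.Bijective f := hu.bijective_id_add_smul (by
    rw [← NNReal.coe_lt_coe]; simpa [abs_of_nonneg ht] using htK)
  have himg : f '' ball 0 R = ball 0 R := by
    have hc : f '' (ball 0 R)ᶜ = (ball 0 R)ᶜ := by
      refine (image_congr fun x hx => ?_).trans (image_id _)
      simp [f, h0 x hx]
    rw [image_compl_eq hbij] at hc
    exact compl_injective hc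
  have hf' : ∀ x ∈ ball (0 : E) R, HasFDerivWithinAt f (1 + t • u' x) (ball 0 R) x := fun x hx =>
    ((hasFDerivAt_id x).add ((hu' x hx).const_smul t)).hasFDerivWithinAt
  have h := integral_image_eq_integral_abs_det_fderiv_smul μ measurableSet_ball hf'
    hbij.1.injOn (fun _ => (1 : ℝ))
  rw [himg] at h
  simp only [integral_const, smul_eq_mul, mul_one, measureReal_restrict_apply_univ] at h
  rw [h]
  refine setIntegral_congr_fun measurableSet_ball fun x hx => ?_
  refine (abs_of_nonneg (ContinuousLinearMap.det_one_add_smul_nonneg _ ht ?_)).symm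
  have hn : ‖u' x‖ ≤ K := (hu' x hx).le_of_lipschitz hu
  exact (mul_le_mul_of_nonneg_left hn ht).trans_lt htK

/-- If `u` is Lipschitz and vanishes off a ball, the Jacobian determinant of `id + u` integrates to
the volume of the ball: the integral for `id + t • u` is a polynomial in `t`, constant for small `t`. -/
theorem setIntegral_det_one_add_of_lipschitzWith
    {u : E → E} {u' : E → E →L[ℝ] E} {K : NNReal} (hu : LipschitzWith K u) {R : ℝ}
    (h0 : ∀ x ∉ ball (0 : E) R, u x = 0) (hu' : ∀ x ∈ ball (0 : E) R, HasFDerivAt u (u' x) x)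
    (hcont : Continuous u') :
    ∫ x in ball (0 : E) R, (1 + u' x).det ∂μ = μ.real (ball 0 R) := by
  set s := Finset.range (finrank ℝ E + 1)
  obtain ⟨δ, hδ, hδK⟩ : ∃ δ : ℝ, 0 < δ ∧ δ * (finrank ℝ E + 1) * K < 1 := by
    refine ⟨((finrank ℝ E + 1) * (K + 1))⁻¹, by positivity, ?_⟩
    have : ((K : ℝ) + 1)⁻¹ * K < 1 := by
      rw [inv_mul_lt_iff₀ (by positivity)]; linarith
    convert this using 1
    field_simp
  set v : ℕ → ℝ := fun i => δ * i
  have hv : InjOn v s := fun i _ j _ hij => by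
    simpa [v, hδ.ne'] using hij
  set c : ℕ → ℝ := fun i => (Lagrange.basis s v i).eval 1
  have hc : ∑ i ∈ s, c i = 1 := by
    have := congrArg (Polynomial.eval 1) (Lagrange.sum_basis hv ⟨0, by simp [s]⟩)
    simpa [eval_finsetSum] using this
  have hdet : ∀ M : E →L[ℝ] E, (1 + M).det = ∑ i ∈ s, c i * (1 + v i • M).det := by
    intro M
    obtain ⟨p, hp, hpe⟩ := M.exists_polynomial_eval_eq_det_one_add_smul
    have hdeg : p.degree < s.card := by
      refine p.degree_le_natDegree.trans_lt ?_
      simp only [s, Finset.card_range]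
      exact_mod_cast Nat.lt_succ_of_le hp
    have h1 := congrArg (Polynomial.eval 1) (Lagrange.eq_interpolate hv hdeg)
    rw [hpe, one_smul, Lagrange.interpolate_apply, eval_finsetSum] at h1
    rw [h1]
    refine Finset.sum_congr rfl fun i _ => ?_
    rw [eval_mul, eval_C, hpe, mul_comm]
  simp only [funext fun x => hdet (u' x)]
  rw [integral_finsetSum]
  · simp_rw [integral_const_mul]
    rw [Finset.sum_congr rfl fun i hi => ?_, ← Finset.sum_mul, hc, one_mul]
    rw [setIntegral_det_one_add_smul_of_lipschitzWith μ hu h0 hu' (by positivity)]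
    refine lt_of_le_of_lt ?_ hδK
    have : (i : ℝ) ≤ finrank ℝ E + 1 := by
      exact_mod_cast (Finset.mem_range.1 hi).le
    exact mul_le_mul_of_nonneg_right (mul_le_mul_of_nonneg_left this hδ.le) K.2
  · intro i _
    have hcd : Continuous fun x => c i * (1 + v i • u' x).det :=
      continuous_const.mul (ContinuousLinearMap.continuous_det.comp (by fun_prop))
    exact (hcd.continuousOn.integrableOn_compact (isCompact_closedBall 0 R)).mono_set
      ball_subset_closedBall
end

/-- There is no `C¹` retraction of a finite-dimensional space onto a sphere. -/
theorem not_exists_contDiff_retraction_sphere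
    {E : Type*} [NormedAddCommGroup E] [InnerProductSpace ℝ E] [FiniteDimensional ℝ E]
    {r : E → E} (hr : ContDiff ℝ 1 r) {R : ℝ} (hR : 0 < R) (hnorm : ∀ x, ‖r x‖ = R)
    (hid : ∀ x ∈ sphere (0 : E) R, r x = x) : False := by
  borelize E
  let μ : Measure E := Measure.addHaar
  have hu1 : ContDiff ℝ 1 fun x => r x - x := hr.sub contDiff_id
  obtain ⟨K, hK⟩ := hu1.contDiffOn.exists_lipschitzOnWith one_ne_zero
    (convex_closedBall (0 : E) R) (isCompact_closedBall 0 R)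
  have hL := hK.lipschitzWith_indicator_closedBall (fun x hx => by simp [hid x hx])
  have hd : ∀ x, HasFDerivAt (fun x => r x - x) (fderiv ℝ r x - 1) x := fun x =>
    ((hr.differentiable one_ne_zero) x).hasFDerivAt.sub (hasFDerivAt_id x)
  have hvol := setIntegral_det_one_add_of_lipschitzWith μ (u' := fun x => fderiv ℝ r x - 1) (R := R)
    hL (fun x hx => ?_) (fun x hx => ?_) ((hr.continuous_fderiv one_ne_zero).sub continuous_const)
  · have hdet : ∀ x, (1 + (fderiv ℝ r x - 1)).det = 0 := by
      intro x
      rw [add_sub_cancel]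
      by_contra hne
      have hsurj : Function.Surjective (fderiv ℝ r x) :=
        ((LinearMap.equivOfDetNeZero (fderiv ℝ r x : E →ₗ[ℝ] E) hne).surjective)
      obtain ⟨w, hw⟩ := hsurj (r x)
      have h1 := (((hr.differentiable one_ne_zero) x).hasFDerivAt.norm_sq)
      have h2 : (fun y => ‖r y‖ ^ 2) = fun _ => R ^ 2 := by
        ext y; rw [hnorm]
      rw [h2] at h1
      have h3 := congrArg (fun L : E →L[ℝ] ℝ => L w) (h1.unique (hasFDerivAt_const _ _))
      simp [hw, hnorm, hR.ne'] at h3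
    simp only [hdet, integral_zero] at hvol
    exact (ENNReal.toReal_pos (measure_ball_pos μ 0 hR).ne' measure_ball_lt_top.ne).ne hvol
  · by_cases h : x ∈ closedBall (0 : E) R
    · rw [indicator_of_mem h, hid x, sub_self]
      exact le_antisymm h (by simpa using hx)
    · exact indicator_of_notMem h _
  · refine (hd x).congr_of_eventuallyEq ?_
    filter_upwards [isOpen_ball.mem_nhds hx] with y hy
    exact indicator_of_mem (ball_subset_closedBall hy) _

/-- A continuous self-map which is the identity off a ball vanishes somewhere. -/
theorem exists_eq_zero_of_eq_id_of_le_norm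
    {E : Type*} [NormedAddCommGroup E] [InnerProductSpace ℝ E] [FiniteDimensional ℝ E]
    {φ : E → E} (hφ : Continuous φ) {R : ℝ} (hR : 0 < R) (hid : ∀ x, R ≤ ‖x‖ → φ x = x) :
    ∃ x, φ x = 0 := by
  by_contra! hne
  obtain ⟨x₀, -, hx₀⟩ := (isCompact_closedBall (0 : E) R).exists_isMinOn
    (nonempty_closedBall.2 hR.le) hφ.norm.continuousOn
  obtain ⟨δ, hδ, hδφ⟩ : ∃ δ : ℝ, 0 < δ ∧ ∀ x, δ ≤ ‖φ x‖ := by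
    refine ⟨min ‖φ x₀‖ R, lt_min (norm_pos_iff.2 (hne x₀)) hR, fun x => ?_⟩
    rcases le_total R ‖x‖ with h | h
    · rw [hid x h]
      exact (min_le_right _ _).trans h
    · exact (min_le_left _ _).trans (hx₀ (by simpa using h))
  obtain ⟨g, hg, hgφ, hsupp⟩ := (hφ.sub continuous_id).exists_contDiff_approx (F := E) 1
    (ε := fun _ => δ) continuous_const (fun _ => hδ)
  have hψ : ContDiff ℝ 1 fun x => x + g x := contDiff_id.add hg
  have hψ0 : ∀ x, x + g x ≠ 0 := by
    intro x hx
    have h := hgφ x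
    rw [dist_eq_norm, eq_neg_of_add_eq_zero_right hx] at h
    have h2 : -x - (φ x - x) = -φ x := by abel
    simp only [Pi.sub_apply, id, h2, norm_neg] at h
    exact (hδφ x).not_gt h
  have hψid : ∀ x, R ≤ ‖x‖ → x + g x = x := by
    intro x hx
    have : g x = 0 := by
      by_contra h
      exact hsupp h (by simp [hid x hx])
    rw [this, add_zero]
  refine not_exists_contDiff_retraction_sphere (r := fun x => (R / ‖x + g x‖) • (x + g x))
    ?_ hR (fun x => ?_) (fun x hx => ?_)
  · exact (contDiff_const.div (hψ.norm ℝ hψ0) fun x => norm_ne_zero_iff.2 (hψ0 x)).smul hψ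
  · rw [norm_smul, norm_div, norm_norm, div_mul_cancel₀ _ (norm_ne_zero_iff.2 (hψ0 x)),
      Real.norm_of_nonneg hR.le]
  · rw [mem_sphere_zero_iff_norm] at hx
    simp only [hψid x hx.ge, hx, div_self hR.ne', one_smul]

/-- A nowhere zero continuous map to `F` from a compact subset of a space of dimension less than
`finrank ℝ F` extends to a nowhere zero continuous map. -/
theorem ContinuousMap.exists_extension_ne_zero_of_finrank_lt
    {X E F : Type*} [TopologicalSpace X] [CompactSpace X]
    [NormedAddCommGroup E] [NormedSpace ℝ E] [FiniteDimensional ℝ E]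
    [NormedAddCommGroup F] [NormedSpace ℝ F] [FiniteDimensional ℝ F]
    (hdim : finrank ℝ E < finrank ℝ F) {e : X → E} (he : Topology.IsClosedEmbedding e)
    (g : C(X, F)) (hg : ∀ x, g x ≠ 0) :
    ∃ G : C(E, F), (∀ y, G y ≠ 0) ∧ ∀ x, G (e x) = g x := by
  obtain ⟨c, hc, hcg⟩ : ∃ c : ℝ, 0 < c ∧ ∀ x, c ≤ ‖g x‖ := by
    rcases isEmpty_or_nonempty X with hX | hX
    · exact ⟨1, one_pos, fun x => hX.elim x⟩
    · obtain ⟨x₀, -, hx₀⟩ := isCompact_univ.exists_isMinOn univ_nonempty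
        g.continuous.norm.continuousOn
      exact ⟨‖g x₀‖, norm_pos_iff.2 (hg x₀), fun x => hx₀ (mem_univ x)⟩
  obtain ⟨h, hh⟩ := g.exists_extension' he
  obtain ⟨p, hp, hph, -⟩ := h.continuous.exists_contDiff_approx 1
    (ε := fun _ => c / 8) continuous_const (fun _ => by positivity)
  obtain ⟨v, hvp, hv⟩ := (hp.dense_compl_range_of_finrank_lt_finrank hdim).exists_dist_lt 0
    (show 0 < c / 8 by positivity)
  rw [dist_zero_left] at hv
  set q : E → F := fun y => p y - v
  have hq0 : ∀ y, q y ≠ 0 := fun y hy => hvp ⟨y, sub_eq_zero.1 hy⟩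
  have hqh : ∀ y, ‖q y - h y‖ < c / 4 := by
    intro y
    have h1 : q y - h y = (p y - h y) - v := by simp only [q]; abel
    rw [h1]
    have h2 := hph y
    rw [dist_eq_norm] at h2
    linarith [norm_sub_le (p y - h y) v]
  set l : E → ℝ := fun y => max 0 (min 1 (4 / c * ‖h y‖ - 3))
  have hl0 : ∀ y, 0 ≤ l y := fun y => le_max_left _ _
  have hl1 : ∀ y, l y ≤ 1 := fun y => max_le zero_le_one (min_le_left _ _)
  have hcont : Continuous fun y => q y + l y • (h y - q y) := by
    have := hp.continuous
    fun_prop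
  refine ⟨⟨_, hcont⟩, fun y hy => ?_, fun x => ?_⟩
  · simp only [ContinuousMap.coe_mk] at hy
    rcases le_or_gt (4 / c * ‖h y‖ - 3) 0 with hle | hlt
    · have : l y = 0 := max_eq_left ((min_le_right _ _).trans hle)
      rw [this, zero_smul, add_zero] at hy
      exact hq0 y hy
    · have h1 : 3 / 4 * c < ‖h y‖ := by
        have : 3 < 4 * ‖h y‖ / c := by
          rw [mul_div_right_comm]; linarith
        rw [lt_div_iff₀ hc] at this
        linarith
      have h2 : h y = -((1 - l y) • (q y - h y)) := by
        rw [eq_neg_iff_add_eq_zero, ← hy]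
        module
      have h3 : ‖h y‖ ≤ ‖q y - h y‖ := by
        conv_lhs => rw [h2]
        rw [norm_neg, norm_smul, Real.norm_of_nonneg (by linarith [hl1 y])]
        exact mul_le_of_le_one_left (norm_nonneg _) (by linarith [hl0 y])
      linarith [hqh y]
  · have hx : h (e x) = g x := congrFun hh x
    have h1 : l (e x) = 1 := by
      have : 4 ≤ 4 / c * ‖g x‖ := by
        rw [← mul_div_right_comm, le_div_iff₀ hc]
        linarith [hcg x]
      simp only [l, hx]
      rw [min_eq_left (by linarith), max_eq_right zero_le_one]
    simp [h1, hx]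

theorem isPreconnected_setOf_lt_norm {E : Type*} [NormedAddCommGroup E] [NormedSpace ℝ E]
    (hE : 1 < Module.rank ℝ E) {R : ℝ} (hR : 0 ≤ R) : IsPreconnected {x : E | R < ‖x‖} := by
  have h := ((isPreconnected_Ioi (a := R)).prod (isPreconnected_sphere hE (0 : E) 1)).image
    (fun z : ℝ × E => z.1 • z.2) (by fun_prop)
  convert h using 1
  ext x
  constructor
  · intro hx
    have hx0 : 0 < ‖x‖ := hR.trans_lt hx
    refine ⟨(‖x‖, ‖x‖⁻¹ • x), ⟨hx, ?_⟩, ?_⟩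
    · simp [norm_smul, hx0.ne']
    · simp [smul_smul, hx0.ne']
  · rintro ⟨⟨s, y⟩, ⟨hs, hy⟩, rfl⟩
    simp only [mem_Ioi, mem_sphere_zero_iff_norm] at hs hy
    simp only [mem_ofPred_eq, norm_smul, hy, mul_one]
    exact hs.trans_le (le_abs_self s)

/-- A compact subset of `E` which embeds in a space of smaller dimension does not separate `E`. -/
theorem IsCompact.isPreconnected_compl_of_isClosedEmbedding
    {E E' : Type*} [NormedAddCommGroup E] [InnerProductSpace ℝ E] [FiniteDimensional ℝ E]
    [NormedAddCommGroup E'] [NormedSpace ℝ E'] [FiniteDimensional ℝ E']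
    (hE : 1 < finrank ℝ E) (hdim : finrank ℝ E' < finrank ℝ E)
    {A : Set E} (hA : IsCompact A) {e : A → E'} (he : Topology.IsClosedEmbedding e) :
    IsPreconnected Aᶜ := by
  have hrank : 1 < Module.rank ℝ E := by
    rw [← finrank_eq_rank]; exact_mod_cast hE
  obtain ⟨R, hR, hAR⟩ := hA.isBounded.exists_pos_norm_le
  have key : ∀ u v : Set E, IsOpen u → IsOpen v → Aᶜ ⊆ u ∪ v → Aᶜ ∩ (u ∩ v) = ∅ →
      {x : E | R < ‖x‖} ⊆ v → Aᶜ ⊆ v := by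
    intro u v hu hv huv hdisj hRv p hpA
    by_contra hpv
    have hpu : p ∈ u := (huv hpA).resolve_right hpv
    have hdisj' : ∀ x, x ∉ A → x ∈ u → x ∉ v := fun x hxA hxu hxv =>
      (hdisj.subset ⟨hxA, hxu, hxv⟩ : x ∈ (∅ : Set E))
    have : CompactSpace A := isCompact_iff_compactSpace.1 hA
    obtain ⟨G, hG0, hG⟩ := ContinuousMap.exists_extension_ne_zero_of_finrank_lt hdim he
      (⟨fun a => a - p, by fun_prop⟩ : C(A, E))
      (fun a ha => hpA (sub_eq_zero.1 ha ▸ a.2))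
    obtain ⟨H, hH⟩ := (⟨e, he.continuous⟩ : C(A, E')).exists_restrict_eq hA.isClosed
    classical
    have hcont : Continuous ((u ∩ Aᶜ).piecewise (fun x => G (H x)) (fun x => x - p)) := by
      refine Continuous.piecewise (fun x hx => ?_) (by fun_prop) (by fun_prop)
      have hxA : x ∈ A := by
        by_contra hxA
        rw [(hu.inter hA.isClosed.isOpen_compl).frontier_eq] at hx
        have hxv : x ∈ v := (huv hxA).resolve_left fun hxu => hx.2 ⟨hxu, hxA⟩
        obtain ⟨y, hyv, hyu, hyA⟩ := mem_closure_iff.1 hx.1 v hv hxv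
        exact hdisj' y hyA hyu hyv
      have h1 : H x = e ⟨x, hxA⟩ := DFunLike.congr_fun hH ⟨x, hxA⟩
      rw [h1, hG]
      rfl
    obtain ⟨x, hx⟩ := exists_eq_zero_of_eq_id_of_le_norm
      (hcont.comp (continuous_add_const p)) (R := R + ‖p‖ + 1) (by positivity) (fun x hx => by
        have h1 : R < ‖x + p‖ := by
          have := norm_sub_le (x + p) p
          rw [add_sub_cancel_right] at this
          linarith
        have h2 : x + p ∉ u ∩ Aᶜ := fun h => hdisj' _ h.2 h.1 (hRv h1)
        simp [piecewise_eq_of_notMem _ _ _ h2])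
    rw [Function.comp_apply] at hx
    by_cases hxU : x + p ∈ u ∩ Aᶜ
    · rw [piecewise_eq_of_mem _ _ _ hxU] at hx
      exact hG0 _ hx
    · rw [piecewise_eq_of_notMem _ _ _ hxU, sub_eq_zero] at hx
      exact hxU (hx.symm ▸ ⟨hpu, hpA⟩)
  have hext : {x : E | R < ‖x‖} ⊆ Aᶜ := fun x hx hxA => (hAR x hxA).not_gt hx
  rw [isPreconnected_iff_subset_of_disjoint]
  intro u v hu hv huv hdisj
  rcases isPreconnected_iff_subset_of_disjoint.1 (isPreconnected_setOf_lt_norm hrank hR.le) u v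
    hu hv (hext.trans huv) (subset_empty_iff.1 (hdisj ▸ inter_subset_inter_left _ hext)) with h | h
  · exact Or.inl (key v u hv hu (union_comm u v ▸ huv) (inter_comm u v ▸ hdisj) h)
  · exact Or.inr (key u v hu hv huv hdisj h)

/-- Let `m ≥ 2` and let `A ⊆ ℝᵐ` be a closed subset which is
homeomorphic to a closed subset of the sphere `Sᵐ⁻¹` and which separates `ℝᵐ` (i.e.
`ℝᵐ \ A` is disconnected).  Then `A` is homeomorphic to `Sᵐ⁻¹`. -/
theorem separating_closed_subset_of_sphere_is_sphere
    (m : ℕ) (hm : 2 ≤ m)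
    (A : Set (EuclideanSpace ℝ (Fin m)))
    (hA : IsClosed A)
    (hhomeo : ∃ B : Set (Metric.sphere (0 : EuclideanSpace ℝ (Fin m)) 1),
      IsClosed B ∧ Nonempty (A ≃ₜ B))
    (hsep : ¬ IsPreconnected Aᶜ) :
    Nonempty (A ≃ₜ Metric.sphere (0 : EuclideanSpace ℝ (Fin m)) 1) := by
  obtain ⟨B, hB, ⟨h⟩⟩ := hhomeo
  by_cases hBu : B = univ
  · subst hBu
    exact ⟨h.trans (Homeomorph.Set.univ _)⟩
  obtain ⟨v, hv⟩ := (ne_univ_iff_exists_notMem B).1 hBu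
  obtain ⟨n, rfl⟩ : ∃ n, m = n + 1 := ⟨m - 1, by omega⟩
  have : Fact (finrank ℝ (EuclideanSpace ℝ (Fin (n + 1))) = n + 1) := ⟨by simp⟩
  have : CompactSpace B := isCompact_iff_compactSpace.1 hB.isCompact
  have : CompactSpace A := h.symm.compactSpace
  let σ := stereographic' n v
  have hBσ : ∀ b : B, (b : sphere (0 : EuclideanSpace ℝ (Fin (n + 1))) 1) ∈ σ.source := by
    intro b
    rw [stereographic'_source]
    rintro rfl
    exact hv b.2
  have hcont : Continuous fun a : A => σ (h a) :=
    σ.continuousOn.comp_continuous (by fun_prop) fun a => hBσ (h a)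
  have hinj : Function.Injective fun a : A => σ (h a) := fun a b hab =>
    h.injective (Subtype.ext (σ.injOn (hBσ _) (hBσ _) hab))
  refine absurd (IsCompact.isPreconnected_compl_of_isClosedEmbedding ?_ ?_
    (isCompact_iff_compactSpace.2 ‹_›) (hcont.isClosedEmbedding hinj)) hsep
  · simpa using Nat.lt_of_succ_le hm
  · simp
end
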